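/- Let 0 < p < 1/2. There exists a positive constant c_p depending only on p such that for every n ≥ 1 and every martingale f in the Hardy space H_p(G), Σ_{m=1}^{n} ‖σ_m^κ f‖_{H_p}^{p} / m^{2−2p} ≤ c_p ‖f‖_{H_p}^{p}. -/

import Mathlib

open MeasureTheory Filter
open scoped ENNReal

noncomputable section

namespace WalshKaczmarz

/-- The Walsh group `G`: sequences of elements of `ZMod 2` with coordinatewise
addition modulo 2. -/
abbrev G : Type := ℕ → ZMod 2

instance : MeasurableSpace (ZMod 2) := ⊤

/-- The normalized Haar (product) measure on `G`, realized as the pushforward of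
Lebesgue measure on `[0,1)` under the binary digit expansion map. Each coordinate
is uniformly distributed on `ZMod 2` and coordinates are independent.  -/
def μG : Measure G :=
  Measure.map (fun t : ℝ => fun k : ℕ => ((⌊t * 2 ^ (k + 1)⌋ : ℤ) : ZMod 2))
    (volume.restrict (Set.Ico (0 : ℝ) 1))

/-- The dyadic interval `I_n(x)`. -/
def I (n : ℕ) (x : G) : Set G := {y : G | ∀ k < n, y k = x k}

/-- `e n` : the element of `G` whose `n`-th coordinate is `1` and all others `0`. -/
def e (n : ℕ) : G := fun k => if k = n then 1 else 0

/-- The `k`-th Rademacher function `r_k(x) = (-1)^{x_k}`. -/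
def rademacher (k : ℕ) (x : G) : ℝ := (-1 : ℝ) ^ (x k).val

/-- `|n| = max {j : n_j ≠ 0}`, the order of `n ≥ 1`. -/
def order (n : ℕ) : ℕ := Nat.log 2 n

/-- The Walsh–Paley function `w_n = ∏_k r_k^{n_k}`. -/
def walsh (n : ℕ) (x : G) : ℝ :=
  ∏ k ∈ Finset.range n, (if n.testBit k then rademacher k x else 1)

/-- The Walsh–Kaczmarz function `κ_n`. -/
def kacz (n : ℕ) (x : G) : ℝ :=
  if n = 0 then 1 else
    rademacher (order n) x *
      (-1 : ℝ) ^ (∑ k ∈ Finset.range (order n),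
        (if n.testBit k then (x (order n - 1 - k)).val else 0))

/-- Skvortsov's coordinate transformation `τ_A`. -/
def tau (A : ℕ) (x : G) : G := fun k => if k < A then x (A - 1 - k) else x k

/-- The Walsh–Paley Dirichlet kernel `D_n^w`. -/
def dirW (n : ℕ) (x : G) : ℝ := ∑ k ∈ Finset.range n, walsh k x

/-- The Walsh–Kaczmarz Dirichlet kernel `D_n^κ`. -/
def dirK (n : ℕ) (x : G) : ℝ := ∑ k ∈ Finset.range n, kacz k x

/-- The Walsh–Paley Fejér kernel `K_n^w = (1/n) ∑_{k=0}^n D_k^w`. -/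
def fejW (n : ℕ) (x : G) : ℝ := (1 / (n : ℝ)) * ∑ k ∈ Finset.range (n + 1), dirW k x

/-- The Walsh–Kaczmarz Fejér kernel `K_n^κ = (1/n) ∑_{k=0}^n D_k^κ`. -/
def fejK (n : ℕ) (x : G) : ℝ := (1 / (n : ℝ)) * ∑ k ∈ Finset.range (n + 1), dirK k x

/-- The Walsh–Kaczmarz–Fourier coefficient of an integrable function. -/
def coeffK (f : G → ℝ) (k : ℕ) : ℝ := ∫ x, f x * kacz k x ∂μG

/-- The `n`-th Walsh–Kaczmarz partial sum `S_n^κ f`. -/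
def SK (f : G → ℝ) (n : ℕ) (x : G) : ℝ := ∑ k ∈ Finset.range n, coeffK f k * kacz k x

/-- The `n`-th Walsh–Kaczmarz Fejér mean `σ_n^κ f = (1/n) ∑_{j=0}^n S_j^κ f`. -/
def sigmaK (f : G → ℝ) (n : ℕ) (x : G) : ℝ :=
  (1 / (n : ℝ)) * ∑ j ∈ Finset.range (n + 1), SK f j x

/-- `𝔉_n` : the σ-algebra generated by the dyadic intervals of measure `2^{-n}`. -/
def F (n : ℕ) : MeasurableSpace G := MeasurableSpace.generateFrom {s | ∃ x : G, s = I n x}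

/-- A martingale with respect to the filtration `(𝔉_n)` of dyadic σ-algebras. -/
def IsDyadicMartingale (f : ℕ → G → ℝ) : Prop :=
  (∀ n, Integrable (f n) μG) ∧ (∀ n, StronglyMeasurable[F n] (f n)) ∧
    ∀ n, μG[f (n + 1)|F n] =ᵐ[μG] f n

/-- `‖f‖_{H_p}^p = ∫ (f^*)^p dμ` for a martingale `f`, where `f^* = sup_n |f^{(n)}|`
is the maximal function. -/
def martHpNormP (p : ℝ) (f : ℕ → G → ℝ) : ℝ≥0∞ :=
  ∫⁻ x, (⨆ n, ENNReal.ofReal |f n x|) ^ p ∂μG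

/-- The martingale Hardy norm `‖f‖_{H_p} = ‖f^*‖_{L_p}`. -/
def martHpNorm (p : ℝ) (f : ℕ → G → ℝ) : ℝ≥0∞ := martHpNormP p f ^ (1 / p)

/-- Membership in the martingale Hardy space `H_p(G)`. -/
def MemHp (p : ℝ) (f : ℕ → G → ℝ) : Prop :=
  IsDyadicMartingale f ∧ martHpNormP p f < ∞

/-- The maximal function of an integrable function `g`, i.e. of the martingale
`(S_{2^n} g)`:  `g^*(x) = sup_n (1/μ(I_n(x))) |∫_{I_n(x)} g dμ|`. -/
def funMaximal (g : G → ℝ) (x : G) : ℝ≥0∞ :=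
  ⨆ n : ℕ, ENNReal.ofReal |∫ u in I n x, g u ∂μG| / μG (I n x)

/-- `‖g‖_{H_p}^p` for a function `g`, identified with the martingale `(S_{2^n} g)`. -/
def funHpNormP (p : ℝ) (g : G → ℝ) : ℝ≥0∞ := ∫⁻ x, funMaximal g x ^ p ∂μG

/-- `‖g‖_{L_p}^p = ∫ |g|^p dμ`. -/
def funLpNormP (p : ℝ) (g : G → ℝ) : ℝ≥0∞ := ∫⁻ x, ENNReal.ofReal |g x| ^ p ∂μG

/-- The weak `L_p` quasinorm `‖g‖_{L_{p,∞}} = sup_{λ>0} λ μ({|g|>λ})^{1/p}`. -/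
def weakLpNorm (p : ℝ) (g : G → ℝ) : ℝ≥0∞ :=
  ⨆ (t : ℝ) (_ : 0 < t), ENNReal.ofReal t * μG {x : G | t < |g x|} ^ (1 / p)

/-- The Walsh–Kaczmarz–Fourier coefficient of a martingale:
`f̂(i) = lim_k ∫ f^{(k)} κ_i dμ`. -/
def martCoeffK (f : ℕ → G → ℝ) (i : ℕ) : ℝ :=
  limUnder atTop (fun k => ∫ x, f k x * kacz i x ∂μG)

/-- The `n`-th Walsh–Kaczmarz partial sum of a martingale. -/
def martSK (f : ℕ → G → ℝ) (n : ℕ) (x : G) : ℝ :=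
  ∑ k ∈ Finset.range n, martCoeffK f k * kacz k x

/-- The `n`-th Walsh–Kaczmarz Fejér mean of a martingale. -/
def martSigmaK (f : ℕ → G → ℝ) (n : ℕ) (x : G) : ℝ :=
  (1 / (n : ℝ)) * ∑ j ∈ Finset.range (n + 1), martSK f j x

/-- A `p`-atom supported on the dyadic interval `I_n(x₀)`. -/
def IsPAtomOn (p : ℝ) (n : ℕ) (x₀ : G) (a : G → ℝ) : Prop :=
  Measurable a ∧ (∀ y, y ∉ I n x₀ → a y = 0) ∧ (∫ y in I n x₀, a y ∂μG) = 0 ∧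
    ∀ y, ENNReal.ofReal |a y| ≤ μG (I n x₀) ^ (-(1 / p))

/-- A `p`-atom. -/
def IsPAtom (p : ℝ) (a : G → ℝ) : Prop := ∃ n x₀, IsPAtomOn p n x₀ a

end WalshKaczmarz

namespace WalshKaczmarz

/-- The binary digit expansion map defining `μG`. -/
def digits (t : ℝ) : G := fun k => ((⌊t * 2 ^ (k + 1)⌋ : ℤ) : ZMod 2)

lemma measurable_digits : Measurable digits := by
  refine measurable_pi_lambda _ fun k => ?_
  exact (measurable_from_top (f := fun z : ℤ => (z : ZMod 2))).comp
    (Int.measurable_floor.comp (measurable_id.mul_const _))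

lemma measurableSet_I (n : ℕ) (x : G) : MeasurableSet (I n x) := by
  have : I n x = ⋂ k ∈ Finset.range n, (fun y : G => y k) ⁻¹' {x k} := by
    ext y; simp [I]
  rw [this]
  exact Finset.measurableSet_biInter _ fun k _ =>
    measurable_pi_apply k (MeasurableSpace.measurableSet_top)

/-- The integer whose binary digits are the first `n` coordinates of `x`. -/
def leftEnd (x : G) : ℕ → ℕ
  | 0 => 0
  | n + 1 => 2 * leftEnd x n + (x n).val

lemma leftEnd_lt (x : G) (n : ℕ) : leftEnd x n < 2 ^ n := by
  induction n with
  | zero => simp [leftEnd]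
  | succ n ih =>
    have := ZMod.val_lt (x n)
    rw [leftEnd, pow_succ]; omega

lemma digits_mem_I_iff (x : G) (n : ℕ) {t : ℝ} (ht : t ∈ Set.Ico (0 : ℝ) 1) :
    digits t ∈ I n x ↔ ⌊t * 2 ^ n⌋ = (leftEnd x n : ℤ) := by
  induction n with
  | zero =>
    simp only [I, leftEnd, pow_zero, mul_one]
    simp only [not_lt_zero, IsEmpty.forall_iff, implies_true, Set.ofPred_true, Set.mem_univ,
      true_iff]
    exact Int.floor_eq_iff.2 (by simpa using ht)
  | succ n ih =>
    have hsplit : digits t ∈ I (n + 1) x ↔ digits t ∈ I n x ∧ digits t n = x n := by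
      simp only [I, Set.mem_ofPred_eq, Nat.lt_succ_iff_lt_or_eq]
      exact ⟨fun h => ⟨fun k hk => h k (Or.inl hk), h n (Or.inr rfl)⟩,
        fun h k hk => hk.elim (h.1 k) (fun e => e ▸ h.2)⟩
    rw [hsplit, ih]
    set a := ⌊t * 2 ^ n⌋ with ha
    have h1 : (a : ℝ) ≤ t * 2 ^ n := Int.floor_le _
    have h2 : t * 2 ^ n < a + 1 := Int.lt_floor_add_one _
    have hf : ⌊t * 2 ^ (n + 1)⌋ = 2 * a ∨ ⌊t * 2 ^ (n + 1)⌋ = 2 * a + 1 := by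
      have e1 : 2 * a ≤ ⌊t * 2 ^ (n + 1)⌋ := by
        rw [Int.le_floor]; push_cast; rw [pow_succ]; linarith
      have e2 : ⌊t * 2 ^ (n + 1)⌋ < 2 * a + 2 := by
        rw [Int.floor_lt]; push_cast; rw [pow_succ]; linarith
      omega
    have two : (2 : ZMod 2) = 0 := rfl
    simp only [digits, leftEnd]
    have hx : x n = 0 ∨ x n = 1 := by
      generalize x n = c; revert c; decide
    have v0 : (0 : ZMod 2).val = 0 := rfl
    have v1 : (1 : ZMod 2).val = 1 := rfl
    have z01 : (0 : ZMod 2) ≠ 1 := by decide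
    rcases hf with hf | hf <;> rcases hx with hx | hx <;> rw [hf, hx] <;> push_cast <;>
      simp only [two, v0, v1, zero_mul, zero_add, z01, z01.symm, and_false, and_true, false_iff] <;>
      omega

instance : IsProbabilityMeasure μG := by
  unfold μG
  have : IsProbabilityMeasure (volume.restrict (Set.Ico (0 : ℝ) 1)) := ⟨by simp⟩
  exact Measure.isProbabilityMeasure_map measurable_digits.aemeasurable

lemma μG_I (n : ℕ) (x : G) : μG (I n x) = ENNReal.ofReal (1 / 2 ^ n) := by
  have h : μG (I n x) = volume (digits ⁻¹' (I n x) ∩ Set.Ico (0 : ℝ) 1) := by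
    change (Measure.map digits _) _ = _
    rw [Measure.map_apply measurable_digits (measurableSet_I n x),
      Measure.restrict_apply (measurable_digits (measurableSet_I n x))]
  have h2 : digits ⁻¹' (I n x) ∩ Set.Ico (0 : ℝ) 1 =
      Set.Ico ((leftEnd x n : ℝ) / 2 ^ n) ((leftEnd x n + 1 : ℝ) / 2 ^ n) := by
    have hpos : (0 : ℝ) < 2 ^ n := by positivity
    ext t
    constructor
    · rintro ⟨h1, h2⟩
      have := (digits_mem_I_iff x n h2).1 h1
      rw [Int.floor_eq_iff] at this
      push_cast at this
      exact ⟨(div_le_iff₀ hpos).2 this.1, (lt_div_iff₀ hpos).2 this.2⟩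
    · rintro ⟨h1, h2⟩
      rw [div_le_iff₀ hpos] at h1
      rw [lt_div_iff₀ hpos] at h2
      have ht : t ∈ Set.Ico (0 : ℝ) 1 := by
        have hl : (leftEnd x n : ℝ) + 1 ≤ 2 ^ n := by exact_mod_cast leftEnd_lt x n
        constructor
        · by_contra hneg
          push Not at hneg
          have : t * 2 ^ n < 0 := mul_neg_of_neg_of_pos hneg hpos
          have : (0 : ℝ) ≤ leftEnd x n := Nat.cast_nonneg _
          linarith
        · by_contra hge
          push Not at hge
          nlinarith
      refine ⟨(digits_mem_I_iff x n ht).2 ?_, ht⟩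
      rw [Int.floor_eq_iff]
      push_cast
      exact ⟨h1, h2⟩
  rw [h, h2, Real.volume_Ico]
  congr 1
  ring

/-- Extension of a finite sequence by zero. -/
def ext {M : ℕ} (v : Fin M → ZMod 2) : G := fun k => if h : k < M then v ⟨k, h⟩ else 0

/-- The average over all points of `G` supported in the first `M` coordinates. -/
def avg (M : ℕ) (g : G → ℝ) : ℝ := (∑ v : Fin M → ZMod 2, g (ext v)) / 2 ^ M

/-- `g` depends only on the first `n` coordinates. -/
def Cyl {α : Type*} (n : ℕ) (g : G → α) : Prop := ∀ x y : G, (∀ k < n, x k = y k) → g x = g y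

/-- The first `M` coordinates of `x`. -/
def restr (M : ℕ) (x : G) : Fin M → ZMod 2 := fun k => x k

lemma ext_apply_lt {M : ℕ} (v : Fin M → ZMod 2) {k : ℕ} (h : k < M) : ext v k = v ⟨k, h⟩ := by
  simp [ext, h]

lemma ext_restr {M : ℕ} (x : G) {k : ℕ} (h : k < M) : ext (restr M x) k = x k := by
  simp [ext, h, restr]

lemma mem_I_ext_iff {M : ℕ} (v : Fin M → ZMod 2) (x : G) : x ∈ I M (ext v) ↔ v = restr M x := by
  constructor
  · intro h
    funext k
    rw [restr, h k k.2, ext_apply_lt v k.2]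
  · rintro rfl k hk
    rw [ext_restr x hk]

lemma Cyl.mono {α : Type*} {n m : ℕ} {g : G → α} (h : Cyl n g) (hnm : n ≤ m) : Cyl m g :=
  fun x y hxy => h x y fun k hk => hxy k (hk.trans_le hnm)

lemma Cyl.ext_restr {α : Type*} {M : ℕ} {g : G → α} (h : Cyl M g) (x : G) :
    g (ext (restr M x)) = g x := h _ _ fun _ hk => WalshKaczmarz.ext_restr x hk

lemma sum_indicator_ext {α : Type*} [AddCommMonoid α] {M : ℕ} {g : G → α} (h : Cyl M g) (x : G) :
    ∑ v : Fin M → ZMod 2, (I M (ext v)).indicator (fun _ => g (ext v)) x = g x := by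
  classical
  rw [Finset.sum_eq_single (restr M x)]
  · rw [Set.indicator_of_mem ((mem_I_ext_iff _ _).2 rfl), h.ext_restr]
  · intro v _ hv
    exact Set.indicator_of_notMem (fun hx => hv ((mem_I_ext_iff _ _).1 hx)) _
  · simp

lemma Cyl.measurable {α : Type*} [MeasurableSpace α] {M : ℕ} {g : G → α} (h : Cyl M g) :
    Measurable g := by
  intro s _
  have : g ⁻¹' s = ⋃ v ∈ {v : Fin M → ZMod 2 | g (ext v) ∈ s}, I M (ext v) := by
    ext x
    simp only [Set.mem_preimage, Set.mem_iUnion, Set.mem_ofPred_eq, exists_prop, mem_I_ext_iff]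
    constructor
    · intro hx
      exact ⟨_, by rwa [h.ext_restr], rfl⟩
    · rintro ⟨v, hv, rfl⟩
      rwa [h.ext_restr] at hv
  rw [this]
  exact MeasurableSet.biUnion (Set.to_countable _) fun v _ => measurableSet_I _ _

lemma Cyl.integrable {M : ℕ} {g : G → ℝ} (h : Cyl M g) : Integrable g μG := by
  have : g = fun x => ∑ v : Fin M → ZMod 2, (I M (ext v)).indicator (fun _ => g (ext v)) x :=
    funext fun x => (sum_indicator_ext h x).symm
  rw [this]
  exact integrable_finsetSum _ fun v _ =>
    (integrable_const _).indicator (measurableSet_I _ _)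

lemma Cyl.integral_eq {M : ℕ} {g : G → ℝ} (h : Cyl M g) : ∫ x, g x ∂μG = avg M g := by
  have : g = fun x => ∑ v : Fin M → ZMod 2, (I M (ext v)).indicator (fun _ => g (ext v)) x :=
    funext fun x => (sum_indicator_ext h x).symm
  rw [this, integral_finsetSum _ fun v _ =>
    (integrable_const _).indicator (measurableSet_I _ _), ← this, avg, Finset.sum_div]
  refine Finset.sum_congr rfl fun v _ => ?_
  rw [integral_indicator_const _ (measurableSet_I _ _), Measure.real, μG_I,
    ENNReal.toReal_ofReal (by positivity), smul_eq_mul]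
  ring

lemma Cyl.lintegral_eq {M : ℕ} {g : G → ℝ} (h : Cyl M g) (h0 : ∀ x, 0 ≤ g x) :
    ∫⁻ x, ENNReal.ofReal (g x) ∂μG = ENNReal.ofReal (avg M g) := by
  rw [← ofReal_integral_eq_lintegral_ofReal h.integrable (Eventually.of_forall h0), h.integral_eq]

section

open scoped Classical

lemma avg_add (M : ℕ) (g h : G → ℝ) : avg M (fun x => g x + h x) = avg M g + avg M h := by
  simp only [avg, Finset.sum_add_distrib, add_div]

lemma avg_sum {ι : Type*} (M : ℕ) (s : Finset ι) (g : ι → G → ℝ) :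
    avg M (fun x => ∑ i ∈ s, g i x) = ∑ i ∈ s, avg M (g i) := by
  simp only [avg]
  rw [Finset.sum_comm, Finset.sum_div]

lemma avg_const_mul (M : ℕ) (c : ℝ) (g : G → ℝ) : avg M (fun x => c * g x) = c * avg M g := by
  simp only [avg, ← Finset.mul_sum, mul_div_assoc]

lemma avg_neg (M : ℕ) (g : G → ℝ) : avg M (fun x => - g x) = - avg M g := by
  simp only [avg, Finset.sum_neg_distrib, neg_div]

lemma avg_mono (M : ℕ) {g h : G → ℝ} (H : ∀ x, g x ≤ h x) : avg M g ≤ avg M h := by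
  unfold avg
  gcongr
  exact H _

lemma avg_const (M : ℕ) (c : ℝ) : avg M (fun _ => c) = c := by
  simp [avg, ZMod.card]

lemma avg_nonneg (M : ℕ) {g : G → ℝ} (H : ∀ x, 0 ≤ g x) : 0 ≤ avg M g :=
  div_nonneg (Finset.sum_nonneg fun _ _ => H _) (by positivity)

lemma abs_avg_le (M : ℕ) (g : G → ℝ) : |avg M g| ≤ avg M (fun x => |g x|) := by
  unfold avg
  rw [abs_div, abs_of_pos (by positivity : (0 : ℝ) < 2 ^ M)]
  gcongr
  exact Finset.abs_sum_le_sum_abs _ _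

lemma avg_translate {M : ℕ} {g : G → ℝ} (h : Cyl M g) (t : G) :
    avg M (fun x => g (x + t)) = avg M g := by
  unfold avg
  congr 1
  rw [← Equiv.sum_comp (Equiv.addRight (restr M t)) (fun v => g (ext v))]
  refine Finset.sum_congr rfl fun v _ => h _ _ fun k hk => ?_
  simp [ext_apply_lt _ hk, restr]

lemma Cyl.avg_eq {M M' : ℕ} {g : G → ℝ} (h : Cyl M g) (h' : Cyl M' g) : avg M g = avg M' g := by
  rw [← h.integral_eq, h'.integral_eq]

lemma avg_box {M : ℕ} {S : Finset ℕ} (hS : S ⊆ Finset.range M) (d : G) :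
    avg M (fun y => if ∀ k ∈ S, y k = d k then 1 else 0) = (1 / 2) ^ S.card := by
  have h1 : ∀ v : Fin M → ZMod 2, (if ∀ k ∈ S, ext v k = d k then (1 : ℝ) else 0) =
      ∏ k : Fin M, if ((k : ℕ) ∈ S → v k = d k) then 1 else 0 := by
    intro v
    rw [Finset.prod_ite_zero]
    simp only [Finset.mem_univ, forall_const, Finset.prod_const_one]
    refine if_congr ⟨fun h k hk => ?_, fun h k hk => ?_⟩ rfl rfl
    · rw [← h k hk, ext_apply_lt v k.2]
    · have hkM := Finset.mem_range.1 (hS hk)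
      rw [ext_apply_lt v hkM]
      exact h ⟨k, hkM⟩ hk
  have h2 : ∀ k : Fin M, (∑ c : ZMod 2, if ((k : ℕ) ∈ S → c = d k) then (1 : ℝ) else 0) =
      2 * (if (k : ℕ) ∈ S then 1 / 2 else 1) := by
    intro k
    by_cases hk : (k : ℕ) ∈ S
    · simp [hk]
    · simp [hk, ZMod.card]
  unfold avg
  simp only [h1]
  have h3 := Finset.prod_univ_sum (κ := fun _ : Fin M => ZMod 2) (fun _ : Fin M => Finset.univ)
    (fun k c => if ((k : ℕ) ∈ S → c = d k) then (1 : ℝ) else 0)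
  rw [Fintype.piFinset_univ] at h3
  rw [← h3]
  simp only [h2]
  rw [Finset.prod_mul_distrib, Finset.prod_const, Finset.card_univ, Fintype.card_fin,
    mul_div_cancel_left₀ _ (by positivity), Finset.prod_fin_eq_prod_range]
  have : ∀ k ∈ Finset.range M, (if h : k < M then (if k ∈ S then (1 / 2 : ℝ) else 1) else 1) =
      if k ∈ S then (1 / 2 : ℝ) else 1 := by
    intro k hk
    simp [Finset.mem_range.1 hk]
  rw [Finset.prod_congr rfl this, Finset.prod_ite_mem, Finset.inter_eq_right.2 hS,
    Finset.prod_const]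

lemma zmod_two_cases (c : ZMod 2) : c = 0 ∨ c = 1 := by revert c; decide

lemma rademacher_eq (k : ℕ) (x : G) : rademacher k x = if x k = 0 then 1 else -1 := by
  unfold rademacher
  rcases zmod_two_cases (x k) with h | h <;> rw [h]
  · simp
  · have : (1 : ZMod 2).val = 1 := rfl
    simp [this]

lemma rademacher_add (k : ℕ) (x y : G) :
    rademacher k (x + y) = rademacher k x * rademacher k y := by
  simp only [rademacher_eq, Pi.add_apply]
  have : (1 : ZMod 2) + 1 = 0 := rfl
  rcases zmod_two_cases (x k) with h | h <;> rcases zmod_two_cases (y k) with h' | h' <;>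
    simp [h, h', this]

lemma abs_rademacher (k : ℕ) (x : G) : |rademacher k x| = 1 := by
  rw [rademacher_eq]; split_ifs <;> simp

lemma walsh_eq_prod {i l : ℕ} (h : l < 2 ^ i) (x : G) :
    walsh l x = ∏ k ∈ Finset.range i, (if l.testBit k then rademacher k x else 1) := by
  have key : ∀ n, l < 2 ^ n → ∏ k ∈ Finset.range n, (if l.testBit k then rademacher k x else 1) =
      ∏ k ∈ Finset.range (max n i), (if l.testBit k then rademacher k x else 1) := by
    intro n hn
    refine Finset.prod_subset (Finset.range_mono (le_max_left _ _)) fun k _ hk => ?_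
    have : l < 2 ^ k :=
      hn.trans_le (Nat.pow_le_pow_right (by norm_num) (by simpa using hk))
    simp [Nat.testBit_lt_two_pow this]
  rw [walsh, key l Nat.lt_two_pow_self]
  have key' : ∀ n, i ≤ n → ∏ k ∈ Finset.range i, (if l.testBit k then rademacher k x else 1) =
      ∏ k ∈ Finset.range n, (if l.testBit k then rademacher k x else 1) := by
    intro n hn
    refine Finset.prod_subset (Finset.range_mono hn) fun k _ hk => ?_
    have : l < 2 ^ k :=
      h.trans_le (Nat.pow_le_pow_right (by norm_num) (by simpa using hk))
    simp [Nat.testBit_lt_two_pow this]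
  exact (key' _ (le_max_right _ _)).symm

lemma walsh_add_two_pow {j l : ℕ} (h : l < 2 ^ j) (x : G) :
    walsh (2 ^ j + l) x = rademacher j x * walsh l x := by
  have h' : 2 ^ j + l < 2 ^ (j + 1) := by rw [pow_succ]; omega
  rw [walsh_eq_prod h', walsh_eq_prod h, Finset.prod_range_succ, mul_comm]
  congr 1
  · simp [Nat.testBit_two_pow_add_eq, Nat.testBit_lt_two_pow h]
  · refine Finset.prod_congr rfl fun k hk => ?_
    rw [Nat.testBit_two_pow_add_gt (Finset.mem_range.1 hk)]

lemma walsh_add (l : ℕ) (x y : G) : walsh l (x + y) = walsh l x * walsh l y := by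
  rw [walsh, walsh, walsh, ← Finset.prod_mul_distrib]
  refine Finset.prod_congr rfl fun k _ => ?_
  split_ifs
  · exact rademacher_add k x y
  · simp

lemma tau_add (i : ℕ) (x y : G) : tau i (x + y) = tau i x + tau i y := by
  funext k
  simp only [tau, Pi.add_apply]
  split_ifs <;> rfl

lemma order_two_pow_add {i l : ℕ} (h : l < 2 ^ i) : order (2 ^ i + l) = i := by
  rw [order, Nat.log_eq_iff (Or.inr ⟨by norm_num, by positivity⟩), pow_succ]
  omega

lemma kacz_two_pow_add {i l : ℕ} (h : l < 2 ^ i) (x : G) :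
    kacz (2 ^ i + l) x = rademacher i x * walsh l (tau i x) := by
  have h0 : 2 ^ i + l ≠ 0 := by positivity
  rw [kacz, if_neg h0, order_two_pow_add h, walsh_eq_prod h, ← Finset.prod_pow_eq_pow_sum]
  congr 1
  refine Finset.prod_congr rfl fun k hk => ?_
  have hk := Finset.mem_range.1 hk
  rw [Nat.testBit_two_pow_add_gt hk]
  split_ifs
  · simp [rademacher, tau, hk]
  · simp

lemma exists_two_pow_add {n : ℕ} (h : n ≠ 0) : ∃ i l, l < 2 ^ i ∧ n = 2 ^ i + l := by
  have h1 := Nat.pow_log_le_self 2 h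
  have h2 := Nat.lt_pow_succ_log_self (b := 2) (by norm_num) n
  rw [pow_succ] at h2
  exact ⟨Nat.log 2 n, n - 2 ^ Nat.log 2 n, by omega, by omega⟩

lemma kacz_add (n : ℕ) (x y : G) : kacz n (x + y) = kacz n x * kacz n y := by
  by_cases h : n = 0
  · simp [kacz, h]
  · obtain ⟨i, l, hl, rfl⟩ := exists_two_pow_add h
    simp only [kacz_two_pow_add hl, tau_add, walsh_add, rademacher_add]
    ring

lemma cyl_rademacher {i j : ℕ} (h : i < j) : Cyl j (rademacher i) := fun x y hxy => by
  rw [rademacher, rademacher, hxy i h]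

lemma cyl_walsh {i l : ℕ} (h : l < 2 ^ i) : Cyl i (walsh l) := fun x y hxy => by
  rw [walsh_eq_prod h, walsh_eq_prod h]
  refine Finset.prod_congr rfl fun k hk => ?_
  rw [rademacher, rademacher, hxy k (Finset.mem_range.1 hk)]

lemma Cyl.comp_tau {α : Type*} {i : ℕ} {g : G → α} (h : Cyl i g) :
    Cyl i (fun x => g (tau i x)) := fun x y hxy => h _ _ fun k hk => by
  simp only [tau, hk, if_true]
  exact hxy _ (by omega)

lemma cyl_kacz {n M : ℕ} (h : n < 2 ^ M) : Cyl M (kacz n) := fun x y hxy => by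
  by_cases h0 : n = 0
  · simp [kacz, h0]
  · obtain ⟨i, l, hl, rfl⟩ := exists_two_pow_add h0
    have hi : i < M := (Nat.pow_lt_pow_iff_right (a := 2) (by norm_num)).1 (by omega)
    have h1 := ((cyl_walsh hl).comp_tau.mono hi.le) x y hxy
    rw [kacz_two_pow_add hl, kacz_two_pow_add hl, cyl_rademacher hi x y hxy]
    simp only [h1]

lemma dirW_two_pow_add {j r : ℕ} (h : r ≤ 2 ^ j) (x : G) :
    dirW (2 ^ j + r) x = dirW (2 ^ j) x + rademacher j x * dirW r x := by
  rw [dirW, Finset.sum_range_add, dirW, dirW, Finset.mul_sum]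
  congr 1
  refine Finset.sum_congr rfl fun l hl => walsh_add_two_pow ?_ x
  exact (Finset.mem_range.1 hl).trans_le h

lemma mem_I_succ_iff (n : ℕ) (x y : G) : y ∈ I (n + 1) x ↔ y ∈ I n x ∧ y n = x n := by
  simp only [I, Set.mem_ofPred_eq, Nat.lt_succ_iff_lt_or_eq]
  exact ⟨fun h => ⟨fun k hk => h k (Or.inl hk), h n (Or.inr rfl)⟩,
    fun h k hk => hk.elim (h.1 k) (fun e => e ▸ h.2)⟩

lemma dirW_two_pow (j : ℕ) (x : G) : dirW (2 ^ j) x = if x ∈ I j 0 then 2 ^ j else 0 := by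
  induction j with
  | zero => simp [dirW, walsh, I]
  | succ j ih =>
    rw [pow_succ, mul_two, dirW_two_pow_add le_rfl, ih, rademacher_eq, mem_I_succ_iff]
    simp only [Pi.zero_apply]
    split_ifs <;> simp_all
    ring

lemma sum_kacz_block {i r : ℕ} (h : r ≤ 2 ^ i) (x : G) :
    ∑ l ∈ Finset.range r, kacz (2 ^ i + l) x = rademacher i x * dirW r (tau i x) := by
  rw [dirW, Finset.mul_sum]
  exact Finset.sum_congr rfl fun l hl =>
    kacz_two_pow_add ((Finset.mem_range.1 hl).trans_le h) x

lemma tau_mem_I_zero (i : ℕ) (x : G) : tau i x ∈ I i 0 ↔ x ∈ I i 0 := by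
  simp only [I, Set.mem_ofPred_eq, tau, Pi.zero_apply]
  constructor
  · intro h k hk
    have := h (i - 1 - k) (by omega)
    rw [if_pos (by omega)] at this
    rwa [show i - 1 - (i - 1 - k) = k by omega] at this
  · intro h k hk
    rw [if_pos hk]
    exact h _ (by omega)

lemma dirK_two_pow (j : ℕ) (x : G) : dirK (2 ^ j) x = if x ∈ I j 0 then 2 ^ j else 0 := by
  induction j with
  | zero => simp [dirK, kacz, I]
  | succ j ih =>
    have : dirK (2 ^ (j + 1)) x = dirK (2 ^ j) x + rademacher j x * dirW (2 ^ j) (tau j x) := by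
      rw [pow_succ, mul_two, dirK, Finset.sum_range_add, sum_kacz_block le_rfl, dirK]
    rw [this, ih, dirW_two_pow, tau_mem_I_zero, rademacher_eq, mem_I_succ_iff]
    simp only [Pi.zero_apply]
    split_ifs <;> simp_all
    ring

/-- The sum of the first `R` Walsh–Paley Dirichlet kernels. -/
def dirWSum (R : ℕ) (x : G) : ℝ := ∑ r ∈ Finset.range R, dirW r x

/-- A positive majorant of the dyadic Fejér kernels. -/
def fejMajorant (j : ℕ) (x : G) : ℝ :=
  ∑ t ∈ Finset.range (j + 1), 2 ^ (j + t) * (if x ∈ I j (e t) then 1 else 0)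

lemma dirWSum_two_pow_add {j r : ℕ} (h : r ≤ 2 ^ j) (x : G) :
    dirWSum (2 ^ j + r) x = dirWSum (2 ^ j) x + (r * dirW (2 ^ j) x +
      rademacher j x * dirWSum r x) := by
  rw [dirWSum, Finset.sum_range_add, dirWSum, dirWSum, Finset.mul_sum]
  congr 1
  rw [Finset.sum_congr rfl fun l hl => dirW_two_pow_add ((Finset.mem_range.1 hl).le.trans h) x,
    Finset.sum_add_distrib]
  simp

lemma mem_I_e_self (j : ℕ) (x : G) : x ∈ I j (e j) ↔ x ∈ I j 0 := by
  refine forall₂_congr fun k hk => ?_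
  simp [e, hk.ne]

lemma fejMajorant_nonneg (j : ℕ) (x : G) : 0 ≤ fejMajorant j x :=
  Finset.sum_nonneg fun _ _ => by split_ifs <;> positivity

lemma two_pow_mul_dirW_le_fejMajorant (j : ℕ) (x : G) :
    2 ^ j * dirW (2 ^ j) x ≤ fejMajorant j x := by
  have := Finset.single_le_sum (f := fun t => (2 : ℝ) ^ (j + t) * (if x ∈ I j (e t) then 1 else 0))
    (fun t _ => by split_ifs <;> positivity) (Finset.self_mem_range_succ j)
  refine le_trans (le_of_eq ?_) this
  simp only [mem_I_e_self, dirW_two_pow]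
  split_ifs <;> simp [pow_add]

lemma dirWSum_two_pow_bounds (j : ℕ) (x : G) :
    0 ≤ dirWSum (2 ^ j) x ∧ dirWSum (2 ^ j) x ≤ fejMajorant j x := by
  induction j with
  | zero => simp [dirWSum, dirW, fejMajorant_nonneg]
  | succ j ih =>
    have h : dirWSum (2 ^ (j + 1)) x = (1 + rademacher j x) * dirWSum (2 ^ j) x +
        2 ^ j * dirW (2 ^ j) x := by
      rw [pow_succ, mul_two, dirWSum_two_pow_add le_rfl]
      push_cast
      ring
    have hm : fejMajorant (j + 1) x = (∑ t ∈ Finset.range j,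
        2 ^ (j + 1 + t) * (if x ∈ I (j + 1) (e t) then 1 else 0)) +
        2 ^ (j + 1 + j) * (if x ∈ I (j + 1) (e j) then 1 else 0) +
        2 ^ (j + 1 + (j + 1)) * (if x ∈ I (j + 1) 0 then 1 else 0) := by
      rw [fejMajorant, Finset.sum_range_succ, Finset.sum_range_succ]
      simp only [mem_I_e_self]
    have hd : dirW (2 ^ j) x = if x ∈ I j 0 then 2 ^ j else 0 := dirW_two_pow j x
    rw [h, rademacher_eq]
    have hej : e j j = 1 := by simp [e]
    have p1 : (2 : ℝ) ^ (j + 1 + j) = 2 * (2 ^ j * 2 ^ j) := by ring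
    have p2 : (2 : ℝ) ^ (j + 1 + (j + 1)) = 4 * (2 ^ j * 2 ^ j) := by ring
    have pp : (0 : ℝ) < 2 ^ j * 2 ^ j := by positivity
    rcases zmod_two_cases (x j) with hx | hx
    · rw [if_pos hx]
      have hs : ∑ t ∈ Finset.range j,
          2 ^ (j + 1 + t) * (if x ∈ I (j + 1) (e t) then (1 : ℝ) else 0) ≥
          2 * fejMajorant j x - 2 * (2 ^ j * 2 ^ j) * (if x ∈ I j 0 then 1 else 0) := by
        rw [fejMajorant, Finset.sum_range_succ, mul_add, Finset.mul_sum]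
        have : ∀ t ∈ Finset.range j,
            2 ^ (j + 1 + t) * (if x ∈ I (j + 1) (e t) then (1 : ℝ) else 0) =
            2 * (2 ^ (j + t) * (if x ∈ I j (e t) then 1 else 0)) := by
          intro t ht
          have het : e t j = 0 := by simp [e, (Finset.mem_range.1 ht).ne']
          rw [mem_I_succ_iff, hx, het]
          simp only [and_true]
          ring
        rw [Finset.sum_congr rfl this, mem_I_e_self]
        have p3 : (2 : ℝ) ^ (j + j) = (2 ^ j * 2 ^ j) := by ring
        rw [p3]
        linarith
      rw [hm, hd]
      have hI : x ∈ I (j + 1) 0 ↔ x ∈ I j 0 := by simp [mem_I_succ_iff, hx]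
      have hz : (0 : ℝ) ≤ 2 ^ (j + 1 + j) * (if x ∈ I (j + 1) (e j) then (1 : ℝ) else 0) := by
        split_ifs <;> positivity
      rw [hI, p2]
      by_cases hx0 : x ∈ I j 0
      · simp only [hx0, if_true] at hs ⊢
        constructor
        · nlinarith [ih.1]
        · nlinarith [ih.2]
      · simp only [hx0, if_false] at hs ⊢
        constructor
        · nlinarith [ih.1]
        · nlinarith [ih.2]
    · have hx0 : x j ≠ 0 := by rw [hx]; decide
      rw [if_neg hx0, hm, hd]
      have hI : x ∈ I (j + 1) (e j) ↔ x ∈ I j 0 := by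
        rw [mem_I_succ_iff, hx, hej, mem_I_e_self]; simp
      have hs : 0 ≤ ∑ t ∈ Finset.range j,
          2 ^ (j + 1 + t) * (if x ∈ I (j + 1) (e t) then (1 : ℝ) else 0) :=
        Finset.sum_nonneg fun _ _ => by split_ifs <;> positivity
      have hz : (0 : ℝ) ≤ 2 ^ (j + 1 + (j + 1)) * (if x ∈ I (j + 1) 0 then (1 : ℝ) else 0) := by
        split_ifs <;> positivity
      rw [hI, p1]
      split_ifs <;> constructor <;> nlinarith

lemma abs_dirWSum_le {i R : ℕ} (h : R ≤ 2 ^ i) (x : G) :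
    |dirWSum R x| ≤ 2 * ∑ j ∈ Finset.range i, fejMajorant j x := by
  induction i generalizing R with
  | zero =>
    have : R = 0 ∨ R = 1 := by simp at h; omega
    rcases this with rfl | rfl <;> simp [dirWSum, dirW]
  | succ i ih =>
    have hm := fejMajorant_nonneg i x
    rw [Finset.sum_range_succ]
    by_cases hR : R ≤ 2 ^ i
    · linarith [ih hR]
    · obtain ⟨r, rfl⟩ := Nat.exists_eq_add_of_le (not_le.1 hR).le
      have hr : r ≤ 2 ^ i := by rw [pow_succ] at h; omega
      have hr' : (r : ℝ) ≤ 2 ^ i := by exact_mod_cast hr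
      have hd : 0 ≤ dirW (2 ^ i) x := by rw [dirW_two_pow]; split_ifs <;> positivity
      rw [dirWSum_two_pow_add hr]
      have h1 := dirWSum_two_pow_bounds i x
      have h2 := two_pow_mul_dirW_le_fejMajorant i x
      have h3 : |rademacher i x * dirWSum r x| ≤ 2 * ∑ j ∈ Finset.range i, fejMajorant j x := by
        rw [abs_mul, abs_rademacher, one_mul]; exact ih hr
      have h4 : (r : ℝ) * dirW (2 ^ i) x ≤ 2 ^ i * dirW (2 ^ i) x := by gcongr
      have h5 : (0 : ℝ) ≤ r * dirW (2 ^ i) x := by positivity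
      rw [abs_le] at h3 ⊢
      constructor <;> linarith

lemma cyl_dirWSum {i R : ℕ} (h : R ≤ 2 ^ i) : Cyl i (dirWSum R) := fun x y hxy => by
  refine Finset.sum_congr rfl fun r hr => Finset.sum_congr rfl fun l hl => ?_
  have := Finset.mem_range.1 hr
  have := Finset.mem_range.1 hl
  exact cyl_walsh (by omega) x y hxy

lemma rpow_add_le_add_rpow {p a b : ℝ} (hp0 : 0 ≤ p) (hp1 : p ≤ 1) (ha : 0 ≤ a) (hb : 0 ≤ b) :
    (a + b) ^ p ≤ a ^ p + b ^ p := by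
  have := NNReal.rpow_add_le_add_rpow ⟨a, ha⟩ ⟨b, hb⟩ hp0 hp1
  exact_mod_cast this

lemma rpow_sum_le_sum_rpow {ι : Type*} {p : ℝ} (hp0 : 0 < p) (hp1 : p ≤ 1) (s : Finset ι)
    {f : ι → ℝ} (hf : ∀ i ∈ s, 0 ≤ f i) : (∑ i ∈ s, f i) ^ p ≤ ∑ i ∈ s, f i ^ p := by
  induction s using Finset.induction_on with
  | empty => simp [Real.zero_rpow hp0.ne']
  | insert a s ha ih =>
    rw [Finset.sum_insert ha, Finset.sum_insert ha]
    have h1 := ih fun i hi => hf i (Finset.mem_insert_of_mem hi)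
    have h2 := rpow_add_le_add_rpow hp0.le hp1 (hf a (Finset.mem_insert_self a s))
      (Finset.sum_nonneg fun i hi => hf i (Finset.mem_insert_of_mem hi))
    linarith

lemma two_pow_rpow (p : ℝ) (n : ℕ) : ((2 : ℝ) ^ n) ^ p = ((2 : ℝ) ^ p) ^ n :=
  (Real.rpow_pow_comm (by norm_num) p n).symm

lemma half_pow_rpow (p : ℝ) (n : ℕ) : ((1 / 2 : ℝ) ^ n) ^ p = 1 / ((2 : ℝ) ^ p) ^ n := by
  rw [one_div, inv_pow, Real.inv_rpow (by positivity), two_pow_rpow, one_div]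

/-- Convolution with the kernel `r_i · (∑_{r<R} D_r^w) ∘ τ_i`. -/
def blockConv (M i R : ℕ) (g : G → ℝ) (x : G) : ℝ :=
  avg M (fun y => g y * (rademacher i (x + y) * dirWSum R (tau i (x + y))))

lemma blockConv_sum {ι : Type*} (M i R : ℕ) (s : Finset ι) (g : ι → G → ℝ) (x : G) :
    blockConv M i R (fun y => ∑ a ∈ s, g a y) x = ∑ a ∈ s, blockConv M i R (g a) x := by
  simp only [blockConv, Finset.sum_mul]
  exact avg_sum M s _

lemma cyl_blockKernel {i R N : ℕ} (hR : R ≤ 2 ^ i) (hi : i < N) :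
    Cyl N (fun x => rademacher i x * dirWSum R (tau i x)) := fun x y hxy => by
  have h1 := ((cyl_dirWSum hR).comp_tau.mono hi.le) x y hxy
  simp only at h1 ⊢
  rw [h1, cyl_rademacher hi x y hxy]

lemma blockConv_eq_zero {M N i R : ℕ} {g : G → ℝ} {z : G} (hR : R ≤ 2 ^ i) (hi : i < N)
    (hg : ∀ y, y ∉ I N z → g y = 0) (h0 : avg M g = 0) (x : G) : blockConv M i R g x = 0 := by
  have : ∀ y, g y * (rademacher i (x + y) * dirWSum R (tau i (x + y))) =
      (rademacher i (x + z) * dirWSum R (tau i (x + z))) * g y := by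
    intro y
    by_cases hy : y ∈ I N z
    · have := cyl_blockKernel hR hi (x + y) (x + z) fun k hk => by
        simp [hy k hk]
      simp only at this
      rw [this, mul_comm]
    · rw [hg y hy]; ring
  simp only [blockConv, this]
  rw [avg_const_mul, h0, mul_zero]

lemma tau_mem_I_iff {i j : ℕ} (hj : j ≤ i) (t : ℕ) (x y : G) :
    tau i (x + y) ∈ I j (e t) ↔
      ∀ k ∈ Finset.Ico (i - j) i, y k = x k + e t (i - 1 - k) := by
  have key : ∀ a b c : ZMod 2, a + b = c ↔ b = a + c := by decide
  simp only [I, Set.mem_ofPred_eq, tau, Finset.mem_Ico]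
  constructor
  · intro h k hk
    have := h (i - 1 - k) (by omega)
    rw [if_pos (by omega), show i - 1 - (i - 1 - k) = k by omega] at this
    exact (key _ _ _).1 this
  · intro h k hk
    rw [if_pos (by omega)]
    have := h (i - 1 - k) (by omega)
    rw [show i - 1 - (i - 1 - k) = k by omega] at this
    exact (key _ _ _).2 this

/-- The normalized overlap of `I_N(z)` with a translated preimage of `I_j(e_t)` under `τ_i`. -/
def overlap (M i j t N : ℕ) (z x : G) : ℝ :=
  avg M (fun y => if y ∈ I N z ∧ tau i (x + y) ∈ I j (e t) then 1 else 0)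

lemma overlap_nonneg (M i j t N : ℕ) (z x : G) : 0 ≤ overlap M i j t N z x :=
  avg_nonneg M fun _ => by split_ifs <;> norm_num

lemma avg_overlap_rpow_le_high {p : ℝ} (hp0 : 0 < p) {M D N q : ℕ} (t : ℕ) (hM : D + N < M)
    (hq : q ≤ N) (z : G) :
    avg M (fun x => overlap M (D + N) (D + q) t N z x ^ p) ≤
      1 / ((2 : ℝ) ^ p) ^ (D + N) * (1 / 2) ^ q := by
  set c : G := fun k => e t (D + N - 1 - k) with hc
  have hpt : ∀ x, overlap M (D + N) (D + q) t N z x ≤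
      (1 / 2) ^ (D + N) * (if ∀ k ∈ Finset.Ico (N - q) N, x k = (z + c) k then 1 else 0) := by
    intro x
    have key : ∀ a b c : ZMod 2, a = b + c ↔ b = a + c := by decide
    have hbox := avg_box (M := M) (S := Finset.range (D + N)) (by
      intro k hk; simp at hk ⊢; omega) (fun k => if k < N then z k else x k + c k)
    rw [Finset.card_range] at hbox
    rw [← hbox, mul_comm, ← avg_const_mul]
    refine avg_mono M fun y => ?_
    by_cases hy : y ∈ I N z ∧ tau (D + N) (x + y) ∈ I (D + q) (e t)
    · rw [if_pos hy]
      obtain ⟨h1, h2⟩ := hy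
      rw [tau_mem_I_iff (by omega)] at h2
      rw [if_pos, if_pos, mul_one]
      · intro k hk
        by_cases hkN : k < N
        · rw [if_pos hkN]; exact h1 k hkN
        · rw [if_neg hkN]
          refine h2 k ?_
          simp at hk ⊢; omega
      · intro k hk
        rw [Finset.mem_Ico] at hk
        have e1 := h2 k (by simp; omega)
        rw [h1 k hk.2, key] at e1
        exact e1
    · rw [if_neg hy]
      split_ifs <;> simp
  calc avg M (fun x => overlap M (D + N) (D + q) t N z x ^ p)
      ≤ avg M (fun x => 1 / ((2 : ℝ) ^ p) ^ (D + N) *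
          (if ∀ k ∈ Finset.Ico (N - q) N, x k = (z + c) k then 1 else 0)) := by
        refine avg_mono M fun x => ?_
        refine (Real.rpow_le_rpow (overlap_nonneg _ _ _ _ _ _ _) (hpt x) hp0.le).trans ?_
        rw [Real.mul_rpow (by positivity) (by split_ifs <;> norm_num), half_pow_rpow]
        split_ifs <;> simp [Real.zero_rpow hp0.ne']
    _ = 1 / ((2 : ℝ) ^ p) ^ (D + N) * (1 / 2) ^ q := by
        rw [avg_const_mul, avg_box (by intro k hk; simp at hk ⊢; omega), Nat.card_Ico]
        congr 2
        omega

lemma avg_overlap_rpow_le_low {p : ℝ} (hp0 : 0 < p) {M D N j : ℕ} (t : ℕ) (hM : D + N < M)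
    (hj : j ≤ D) (z : G) :
    avg M (fun x => overlap M (D + N) j t N z x ^ p) ≤ 1 / ((2 : ℝ) ^ p) ^ (N + j) := by
  have hpt : ∀ x, overlap M (D + N) j t N z x ≤ (1 / 2) ^ (N + j) := by
    intro x
    have hdisj : Disjoint (Finset.range N) (Finset.Ico (D + N - j) (D + N)) := by
      rw [Finset.disjoint_left]; intro k hk; simp at hk ⊢; omega
    have hcard : (Finset.range N ∪ Finset.Ico (D + N - j) (D + N)).card = N + j := by
      rw [Finset.card_union_of_disjoint hdisj]; simp; omega
    rw [← hcard, ← avg_box (M := M) (by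
      intro k hk; simp at hk ⊢; omega)
      (fun k => if k < N then z k else x k + e t (D + N - 1 - k))]
    refine avg_mono M fun y => ?_
    by_cases hy : y ∈ I N z ∧ tau (D + N) (x + y) ∈ I j (e t)
    · rw [if_pos hy, if_pos]
      obtain ⟨h1, h2⟩ := hy
      rw [tau_mem_I_iff (by omega)] at h2
      intro k hk
      by_cases hkN : k < N
      · rw [if_pos hkN]; exact h1 k hkN
      · rw [if_neg hkN]
        refine h2 k ?_
        simp at hk ⊢; omega
    · rw [if_neg hy]
      split_ifs <;> simp
  refine (avg_mono M (h := fun _ => 1 / ((2 : ℝ) ^ p) ^ (N + j)) fun x => ?_).trans_eq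
    (avg_const M _)
  rw [← half_pow_rpow]
  exact Real.rpow_le_rpow (overlap_nonneg _ _ _ _ _ _ _) (hpt x) hp0.le

lemma abs_blockConv_le {M i R N : ℕ} {g : G → ℝ} {z : G} {c : ℝ} (hR : R ≤ 2 ^ i)
    (hg : ∀ y, y ∉ I N z → g y = 0) (hc : ∀ y, |g y| ≤ c) (x : G) :
    |blockConv M i R g x| ≤ (2 * c) * ∑ j ∈ Finset.range i, ∑ t ∈ Finset.range (j + 1),
      2 ^ (j + t) * overlap M i j t N z x := by
  have hc0 : 0 ≤ c := (abs_nonneg _).trans (hc 0)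
  calc |blockConv M i R g x|
      ≤ avg M (fun y => |g y * (rademacher i (x + y) * dirWSum R (tau i (x + y)))|) :=
        abs_avg_le M _
    _ ≤ avg M (fun y => (2 * c) * ∑ j ∈ Finset.range i, ∑ t ∈ Finset.range (j + 1),
          2 ^ (j + t) * (if y ∈ I N z ∧ tau i (x + y) ∈ I j (e t) then 1 else 0)) := by
        refine avg_mono M fun y => ?_
        by_cases hy : y ∈ I N z
        · rw [abs_mul, abs_mul, abs_rademacher, one_mul]
          have h1 := abs_dirWSum_le hR (tau i (x + y))
          simp only [fejMajorant] at h1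
          simp only [hy, true_and]
          calc |g y| * |dirWSum R (tau i (x + y))| ≤ c * _ :=
                mul_le_mul (hc y) h1 (abs_nonneg _) hc0
            _ = _ := by ring
        · simp [hg y hy, hy]
    _ = _ := by
        rw [avg_const_mul, avg_sum]
        congr 1
        refine Finset.sum_congr rfl fun j _ => ?_
        rw [avg_sum]
        exact Finset.sum_congr rfl fun t _ => avg_const_mul M _ _

lemma geom_sum_le_of_one_lt {b : ℝ} (hb : 1 < b) (n : ℕ) :
    ∑ k ∈ Finset.range n, b ^ k ≤ b ^ n / (b - 1) := by
  rw [geom_sum_eq hb.ne']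
  have : 0 < b - 1 := by linarith
  gcongr
  linarith

lemma geom_sum_le_of_lt_one {b : ℝ} (h0 : 0 ≤ b) (hb : b < 1) (n : ℕ) :
    ∑ k ∈ Finset.range n, b ^ k ≤ 1 / (1 - b) := by
  have h : 0 < 1 - b := by linarith
  rw [le_div_iff₀ h, geom_sum_mul_neg]
  linarith [pow_nonneg h0 n]

/-- The constant in the `L_p` estimate of `blockConv` on atoms, with `b = 2 ^ p`. -/
def blockConst (b : ℝ) : ℝ := b * (b / (b - 1) * (1 / (b - 1) + 1 / (1 - b ^ 2 / 2)))

lemma avg_blockConv_rpow_le {p : ℝ} (hp0 : 0 < p) (hp : p < 1 / 2) {M D N R : ℕ} {g : G → ℝ}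
    {z : G} {c : ℝ} (hM : D + N < M) (hR : R ≤ 2 ^ (D + N))
    (hg : ∀ y, y ∉ I N z → g y = 0) (hc : ∀ y, |g y| ≤ c) :
    avg M (fun x => |blockConv M (D + N) R g x| ^ p) ≤
      blockConst (2 ^ p) * c ^ p * (((2 : ℝ) ^ p) ^ D / ((2 : ℝ) ^ p) ^ N) := by
  have hc0 : 0 ≤ c := (abs_nonneg _).trans (hc 0)
  have hp1 : p ≤ 1 := by linarith
  set b : ℝ := 2 ^ p with hb
  have hb1 : 1 < b := Real.one_lt_rpow (by norm_num) hp0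
  have hb2 : b ^ 2 / 2 < 1 := by
    rw [hb, ← Real.rpow_natCast, ← Real.rpow_mul (by norm_num), div_lt_one (by norm_num)]
    calc (2 : ℝ) ^ (p * (2 : ℕ)) < 2 ^ (1 : ℝ) :=
          Real.rpow_lt_rpow_of_exponent_lt (by norm_num) (by push_cast; linarith)
      _ = 2 := Real.rpow_one 2
  have hb0 : 0 < b := by linarith
  have hbm : 0 < b - 1 := by linarith
  have step1 : avg M (fun x => |blockConv M (D + N) R g x| ^ p) ≤
      b * c ^ p * ∑ j ∈ Finset.range (D + N), ∑ t ∈ Finset.range (j + 1),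
        b ^ (j + t) * avg M (fun x => overlap M (D + N) j t N z x ^ p) := by
    have : ∀ x, |blockConv M (D + N) R g x| ^ p ≤
        b * c ^ p * ∑ j ∈ Finset.range (D + N), ∑ t ∈ Finset.range (j + 1),
          b ^ (j + t) * overlap M (D + N) j t N z x ^ p := by
      intro x
      refine (Real.rpow_le_rpow (abs_nonneg _) (abs_blockConv_le hR hg hc x) hp0.le).trans ?_
      have hnn : ∀ j t, 0 ≤ (2 : ℝ) ^ (j + t) * overlap M (D + N) j t N z x := fun j t =>
        mul_nonneg (by positivity) (overlap_nonneg _ _ _ _ _ _ _)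
      rw [Real.mul_rpow (by positivity)
        (Finset.sum_nonneg fun j _ => Finset.sum_nonneg fun t _ => hnn j t),
        Real.mul_rpow (by norm_num) hc0]
      refine mul_le_mul_of_nonneg_left ?_ (by positivity)
      refine (rpow_sum_le_sum_rpow hp0 hp1 _ fun j _ =>
        Finset.sum_nonneg fun t _ => hnn j t).trans (Finset.sum_le_sum fun j _ => ?_)
      refine (rpow_sum_le_sum_rpow hp0 hp1 _ fun t _ => hnn j t).trans
        (Finset.sum_le_sum fun t _ => ?_)
      rw [Real.mul_rpow (by positivity) (overlap_nonneg _ _ _ _ _ _ _), two_pow_rpow]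
    refine (avg_mono M this).trans_eq ?_
    rw [avg_const_mul, avg_sum]
    congr 1
    refine Finset.sum_congr rfl fun j _ => ?_
    rw [avg_sum]
    exact Finset.sum_congr rfl fun t _ => avg_const_mul M _ _
  have inner : ∀ (j : ℕ) (A : ℝ), 0 ≤ A →
      (∀ t, avg M (fun x => overlap M (D + N) j t N z x ^ p) ≤ A) →
      ∑ t ∈ Finset.range (j + 1), b ^ (j + t) * avg M (fun x => overlap M (D + N) j t N z x ^ p)
        ≤ b / (b - 1) * (b ^ (2 * j) * A) := by
    intro j A hA hle
    calc _ ≤ ∑ t ∈ Finset.range (j + 1), b ^ (j + t) * A :=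
          Finset.sum_le_sum fun t _ => mul_le_mul_of_nonneg_left (hle t) (by positivity)
      _ = b ^ j * A * ∑ t ∈ Finset.range (j + 1), b ^ t := by
          rw [Finset.mul_sum]
          exact Finset.sum_congr rfl fun t _ => by ring
      _ ≤ b ^ j * A * (b ^ (j + 1) / (b - 1)) :=
          mul_le_mul_of_nonneg_left (geom_sum_le_of_one_lt hb1 _) (by positivity)
      _ = _ := by ring
  refine step1.trans ?_
  rw [Finset.sum_range_add]
  have low : ∑ j ∈ Finset.range D, ∑ t ∈ Finset.range (j + 1),
      b ^ (j + t) * avg M (fun x => overlap M (D + N) j t N z x ^ p) ≤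
      b / (b - 1) * (1 / (b - 1) * (b ^ D / b ^ N)) := by
    calc _ ≤ ∑ j ∈ Finset.range D, b / (b - 1) * (b ^ (2 * j) * (1 / b ^ (N + j))) :=
          Finset.sum_le_sum fun j hj => inner j _ (by positivity) fun t =>
            avg_overlap_rpow_le_low hp0 t hM (Finset.mem_range.1 hj).le z
      _ = b / (b - 1) * (1 / b ^ N * ∑ j ∈ Finset.range D, b ^ j) := by
          rw [Finset.mul_sum, Finset.mul_sum]
          refine Finset.sum_congr rfl fun j _ => ?_
          rw [pow_add, two_mul, pow_add]
          field_simp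
      _ ≤ b / (b - 1) * (1 / b ^ N * (b ^ D / (b - 1))) := by
          gcongr
          exact geom_sum_le_of_one_lt hb1 _
      _ = _ := by ring
  have high : ∑ q ∈ Finset.range N, ∑ t ∈ Finset.range (D + q + 1),
      b ^ (D + q + t) * avg M (fun x => overlap M (D + N) (D + q) t N z x ^ p) ≤
      b / (b - 1) * (1 / (1 - b ^ 2 / 2) * (b ^ D / b ^ N)) := by
    calc _ ≤ ∑ q ∈ Finset.range N, b / (b - 1) *
            (b ^ (2 * (D + q)) * (1 / b ^ (D + N) * (1 / 2) ^ q)) :=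
          Finset.sum_le_sum fun q hq => inner (D + q) _ (by positivity) fun t =>
            avg_overlap_rpow_le_high hp0 t hM (Finset.mem_range.1 hq).le z
      _ = b / (b - 1) * (b ^ D / b ^ N * ∑ q ∈ Finset.range N, (b ^ 2 / 2) ^ q) := by
          rw [Finset.mul_sum, Finset.mul_sum]
          refine Finset.sum_congr rfl fun q _ => ?_
          rw [pow_add, div_pow, div_pow, one_pow, ← pow_mul, mul_add, pow_add, two_mul D, pow_add]
          field_simp
      _ ≤ b / (b - 1) * (b ^ D / b ^ N * (1 / (1 - b ^ 2 / 2))) := by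
          gcongr
          exact geom_sum_le_of_lt_one (by positivity) hb2 _
      _ = _ := by ring
  calc _ ≤ b * c ^ p * (b / (b - 1) * (1 / (b - 1) * (b ^ D / b ^ N)) +
        b / (b - 1) * (1 / (1 - b ^ 2 / 2) * (b ^ D / b ^ N))) := by gcongr
    _ = _ := by rw [blockConst]; ring

lemma one_lt_two_rpow {p : ℝ} (hp0 : 0 < p) : (1 : ℝ) < 2 ^ p :=
  Real.one_lt_rpow (by norm_num) hp0

lemma two_rpow_sq_div_two_lt_one {p : ℝ} (hp : p < 1 / 2) : ((2 : ℝ) ^ p) ^ 2 / 2 < 1 := by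
  rw [← Real.rpow_natCast, ← Real.rpow_mul (by norm_num), div_lt_one (by norm_num)]
  calc (2 : ℝ) ^ (p * (2 : ℕ)) < 2 ^ (1 : ℝ) :=
        Real.rpow_lt_rpow_of_exponent_lt (by norm_num) (by push_cast; linarith)
    _ = 2 := Real.rpow_one 2

lemma sum_Icc_log_le (n : ℕ) {h : ℕ → ℝ} (h0 : ∀ A, 0 ≤ h A) :
    ∑ m ∈ Finset.Icc 1 n, h (Nat.log 2 m) ≤ ∑ A ∈ Finset.range (Nat.log 2 n + 1), 2 ^ A * h A := by
  rw [← Finset.sum_fiberwise_of_maps_to (s := Finset.Icc 1 n)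
    (t := Finset.range (Nat.log 2 n + 1)) (g := Nat.log 2) (by
      intro m hm
      rw [Finset.mem_range, Nat.lt_succ_iff]
      exact Nat.log_mono_right (Finset.mem_Icc.1 hm).2)]
  refine Finset.sum_le_sum fun A _ => ?_
  rw [Finset.sum_congr rfl fun m hm => by rw [(Finset.mem_filter.1 hm).2], Finset.sum_const,
    nsmul_eq_mul]
  refine mul_le_mul_of_nonneg_right ?_ (h0 A)
  have : (Finset.Icc 1 n).filter (fun m => Nat.log 2 m = A) ⊆ Finset.Ico (2 ^ A) (2 ^ (A + 1)) := by
    intro m hm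
    rw [Finset.mem_filter, Finset.mem_Icc] at hm
    have := (Nat.log_eq_iff (Or.inr ⟨by norm_num, by omega⟩)).1 hm.2
    exact Finset.mem_Ico.2 this
  have := Finset.card_le_card this
  rw [Nat.card_Ico, pow_succ] at this
  have h2 : ((Finset.Icc 1 n).filter (fun m => Nat.log 2 m = A)).card ≤ 2 ^ A := by omega
  exact_mod_cast h2

lemma geom_tail_le {ρ : ℝ} (h0 : 0 ≤ ρ) (h1 : ρ < 1) (N L : ℕ) :
    ∑ A ∈ Finset.range L, (if N ≤ A then ρ ^ A else 0) ≤ ρ ^ N / (1 - ρ) := by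
  have h : 0 < 1 - ρ := by linarith
  calc _ ≤ ∑ A ∈ Finset.range (N + L), (if N ≤ A then ρ ^ A else 0) :=
        Finset.sum_le_sum_of_subset_of_nonneg (Finset.range_mono (by omega)) fun A _ _ => by
          split_ifs <;> positivity
    _ = ρ ^ N * ∑ A ∈ Finset.range L, ρ ^ A := by
        rw [Finset.sum_range_add, Finset.sum_eq_zero, zero_add, Finset.mul_sum]
        · refine Finset.sum_congr rfl fun A _ => ?_
          rw [if_pos (by omega), pow_add]
        · intro A hA
          rw [if_neg (by simpa using hA)]
    _ ≤ ρ ^ N * (1 / (1 - ρ)) := by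
        gcongr
        exact geom_sum_le_of_lt_one h0 h1 L
    _ = _ := by ring

/-- The number of indices `j ≤ m` in the block `[2 ^ i, 2 ^ (i + 1))`. -/
def blockLen (m i : ℕ) : ℕ := min (2 ^ i) (m + 1 - 2 ^ i)

lemma blockLen_le (m i : ℕ) : blockLen m i ≤ 2 ^ i := min_le_left _ _

/-- The weighted sum of the `p`-th powers of the `L_p` norms of all block convolutions. -/
def blockTotal (p : ℝ) (M n : ℕ) (g : G → ℝ) : ℝ :=
  ∑ m ∈ Finset.Icc 1 n, 1 / ((m : ℝ) ^ (2 - 2 * p) * (m : ℝ) ^ p) *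
    ∑ i ∈ Finset.range (Nat.log 2 m + 1), avg M (fun x => |blockConv M i (blockLen m i) g x| ^ p)

lemma blockTotal_sum_le {ι : Type*} {p : ℝ} (hp0 : 0 < p) (hp1 : p ≤ 1) (M n : ℕ) (s : Finset ι)
    (g : ι → G → ℝ) :
    blockTotal p M n (fun x => ∑ a ∈ s, g a x) ≤ ∑ a ∈ s, blockTotal p M n (g a) := by
  unfold blockTotal
  rw [Finset.sum_comm]
  refine Finset.sum_le_sum fun m _ => ?_
  rw [← Finset.mul_sum, Finset.sum_comm]
  refine mul_le_mul_of_nonneg_left (Finset.sum_le_sum fun i _ => ?_) (by positivity)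
  rw [← avg_sum]
  refine avg_mono M fun x => ?_
  rw [blockConv_sum]
  refine (Real.rpow_le_rpow (abs_nonneg _) (Finset.abs_sum_le_sum_abs _ _) hp0.le).trans ?_
  exact rpow_sum_le_sum_rpow hp0 hp1 _ fun _ _ => abs_nonneg _

lemma blockTotal_add_le {p : ℝ} (hp0 : 0 < p) (hp1 : p ≤ 1) (M n : ℕ) (g h : G → ℝ) :
    blockTotal p M n (fun x => g x + h x) ≤ blockTotal p M n g + blockTotal p M n h := by
  have := blockTotal_sum_le hp0 hp1 M n Finset.univ ![g, h]
  simpa [Fin.sum_univ_two] using this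

/-- The constant in the estimate of `blockTotal` on atoms, with `b = 2 ^ p`. -/
def atomConst (b : ℝ) : ℝ := blockConst b * (b / (b - 1)) * (1 / (1 - b ^ 2 / 2))

lemma blockConst_pos {p : ℝ} (hp0 : 0 < p) (hp : p < 1 / 2) : 0 < blockConst (2 ^ p) := by
  have h1 : (0 : ℝ) < 2 ^ p - 1 := sub_pos.2 (one_lt_two_rpow hp0)
  have h2 : (0 : ℝ) < 1 - ((2 : ℝ) ^ p) ^ 2 / 2 := sub_pos.2 (two_rpow_sq_div_two_lt_one hp)
  unfold blockConst
  positivity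

lemma atomConst_pos {p : ℝ} (hp0 : 0 < p) (hp : p < 1 / 2) : 0 < atomConst (2 ^ p) := by
  have h0 := blockConst_pos hp0 hp
  have h1 : (0 : ℝ) < 2 ^ p - 1 := sub_pos.2 (one_lt_two_rpow hp0)
  have h2 : (0 : ℝ) < 1 - ((2 : ℝ) ^ p) ^ 2 / 2 := sub_pos.2 (two_rpow_sq_div_two_lt_one hp)
  unfold atomConst
  positivity

lemma one_div_natCast_rpow_le {s : ℝ} (hs : 0 ≤ s) {m : ℕ} (hm : 1 ≤ m) :
    1 / (m : ℝ) ^ s ≤ 1 / ((2 : ℝ) ^ Nat.log 2 m) ^ s := by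
  have : ((2 : ℝ) ^ Nat.log 2 m) ≤ m := by exact_mod_cast Nat.pow_log_le_self 2 (by omega)
  gcongr

lemma two_pow_rpow_two_sub (p : ℝ) (A : ℕ) :
    ((2 : ℝ) ^ A) ^ (2 - 2 * p) = 4 ^ A / (((2 : ℝ) ^ p) ^ 2) ^ A := by
  have h : (0 : ℝ) < 2 ^ A := by positivity
  have h1 : ((2 : ℝ) ^ A) ^ (2 : ℝ) = 4 ^ A := by
    rw [Real.rpow_two, ← pow_mul, mul_comm, pow_mul]
    norm_num
  have h2 : (((2 : ℝ) ^ A) ^ p) ^ (2 : ℝ) = (((2 : ℝ) ^ p) ^ 2) ^ A := by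
    rw [Real.rpow_two, two_pow_rpow]
    ring
  rw [Real.rpow_sub h, mul_comm 2 p, Real.rpow_mul h.le, h1, h2]

lemma blockTotal_atom_le {p : ℝ} (hp0 : 0 < p) (hp : p < 1 / 2) {M n N : ℕ} {g : G → ℝ}
    {z : G} {c : ℝ} (hn : Nat.log 2 n < M)
    (hg : ∀ y, y ∉ I N z → g y = 0) (hc : ∀ y, |g y| ≤ c) (hN : N = 0 ∨ avg M g = 0) :
    blockTotal p M n g ≤ atomConst (2 ^ p) * c ^ p * (1 / 2 ^ N) := by
  have hc0 : 0 ≤ c := (abs_nonneg _).trans (hc 0)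
  have hK := blockConst_pos hp0 hp
  have hb1 := one_lt_two_rpow hp0
  have hb2 := two_rpow_sq_div_two_lt_one hp
  set b : ℝ := 2 ^ p with hb
  have hb0 : 0 < b := by linarith
  have hbm : 0 < b - 1 := by linarith
  have hρ : 0 < 1 - b ^ 2 / 2 := by linarith
  have inner : ∀ m ∈ Finset.Icc 1 n, ∑ i ∈ Finset.range (Nat.log 2 m + 1),
      avg M (fun x => |blockConv M i (blockLen m i) g x| ^ p) ≤
      if N ≤ Nat.log 2 m then
        blockConst b * c ^ p * (b / (b - 1)) * (b ^ Nat.log 2 m / (b ^ N * b ^ N)) else 0 := by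
    intro m hm
    have hmM : Nat.log 2 m < M := (Nat.log_mono_right (Finset.mem_Icc.1 hm).2).trans_lt hn
    have hz : ∀ i < N, avg M (fun x => |blockConv M i (blockLen m i) g x| ^ p) = 0 := by
      intro i hi
      have h0 : avg M g = 0 := hN.resolve_left (by omega)
      simp only [blockConv_eq_zero (blockLen_le m i) hi hg h0, abs_zero,
        Real.zero_rpow hp0.ne', avg_const]
    split_ifs with hNA
    · obtain ⟨d, hd⟩ := Nat.exists_eq_add_of_le hNA
      rw [hd, add_assoc, Finset.sum_range_add,
        Finset.sum_eq_zero fun i hi => hz i (Finset.mem_range.1 hi), zero_add]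
      calc _ ≤ ∑ q ∈ Finset.range (d + 1), blockConst b * c ^ p * (b ^ q / b ^ N) := by
            refine Finset.sum_le_sum fun q hq => ?_
            have hq := Finset.mem_range.1 hq
            rw [add_comm N q]
            exact avg_blockConv_rpow_le hp0 hp (by omega) (blockLen_le _ _) hg hc
        _ = blockConst b * c ^ p * (1 / b ^ N) * ∑ q ∈ Finset.range (d + 1), b ^ q := by
            rw [Finset.mul_sum]
            exact Finset.sum_congr rfl fun q _ => by ring
        _ ≤ blockConst b * c ^ p * (1 / b ^ N) * (b ^ (d + 1) / (b - 1)) := by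
            gcongr
            exact geom_sum_le_of_one_lt hb1 _
        _ = _ := by
            rw [pow_add b N d, pow_succ]
            field_simp
    · rw [Finset.sum_eq_zero]
      intro i hi
      exact hz i (by have := Finset.mem_range.1 hi; omega)
  have weight : ∀ m ∈ Finset.Icc 1 n, 1 / ((m : ℝ) ^ (2 - 2 * p) * (m : ℝ) ^ p) ≤
      (b / 4) ^ Nat.log 2 m := by
    intro m hm
    have hm1 := (Finset.mem_Icc.1 hm).1
    have h1 := one_div_natCast_rpow_le (s := 2 - 2 * p) (by linarith) hm1
    have h2 := one_div_natCast_rpow_le (s := p) hp0.le hm1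
    rw [two_pow_rpow_two_sub] at h1
    rw [two_pow_rpow] at h2
    rw [← one_div_mul_one_div]
    calc _ ≤ (1 / (4 ^ Nat.log 2 m / (b ^ 2) ^ Nat.log 2 m)) * (1 / b ^ Nat.log 2 m) :=
          mul_le_mul h1 h2 (by positivity) (by positivity)
      _ = _ := by
          rw [div_pow]
          field_simp
          ring
  calc blockTotal p M n g
      ≤ ∑ m ∈ Finset.Icc 1 n, (blockConst b * c ^ p * (b / (b - 1)) * (1 / (b ^ N * b ^ N))) *
        (if N ≤ Nat.log 2 m then (b ^ 2 / 4) ^ Nat.log 2 m else 0) := by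
        refine Finset.sum_le_sum fun m hm => ?_
        have hin0 : 0 ≤ ∑ i ∈ Finset.range (Nat.log 2 m + 1),
            avg M (fun x => |blockConv M i (blockLen m i) g x| ^ p) :=
          Finset.sum_nonneg fun i _ => avg_nonneg M fun x => by positivity
        refine (mul_le_mul (weight m hm) (inner m hm) hin0 (by positivity)).trans_eq ?_
        split_ifs
        · rw [div_pow, div_pow]; ring
        · simp
    _ ≤ (blockConst b * c ^ p * (b / (b - 1)) * (1 / (b ^ N * b ^ N))) *
        ∑ A ∈ Finset.range (Nat.log 2 n + 1), (if N ≤ A then (b ^ 2 / 2) ^ A else 0) := by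
        rw [← Finset.mul_sum]
        refine mul_le_mul_of_nonneg_left ?_ (by positivity)
        refine (sum_Icc_log_le n (h := fun A => if N ≤ A then (b ^ 2 / 4) ^ A else 0)
          fun A => by split_ifs <;> positivity).trans_eq (Finset.sum_congr rfl fun A _ => ?_)
        split_ifs
        · rw [← mul_pow]; congr 1; ring
        · simp
    _ ≤ (blockConst b * c ^ p * (b / (b - 1)) * (1 / (b ^ N * b ^ N))) *
        ((b ^ 2 / 2) ^ N / (1 - b ^ 2 / 2)) := by
        gcongr
        exact geom_tail_le (by positivity) hb2 _ _
    _ = _ := by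
        rw [atomConst, div_pow, ← pow_mul, mul_comm 2 N, mul_two, pow_add]
        field_simp

lemma add_e_add_e (x : G) (i : ℕ) : x + e i + e i = x := by
  have : ∀ a : ZMod 2, a + a = 0 := by decide
  funext k
  simp only [Pi.add_apply, add_assoc, this, add_zero]

lemma add_e_apply_of_ne (x : G) {i k : ℕ} (h : k ≠ i) : (x + e i) k = x k := by
  simp [e, h]

lemma Cyl.of_succ {α : Type*} {n : ℕ} {g : G → α} (h : Cyl (n + 1) g)
    (hs : ∀ x, g (x + e n) = g x) : Cyl n g := by
  intro x y hxy
  by_cases hn : x n = y n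
  · exact h x y fun k hk => (Nat.lt_succ_iff_lt_or_eq.1 hk).elim (hxy k) (fun hk => hk ▸ hn)
  · rw [← hs y]
    refine h x _ fun k hk => ?_
    rcases Nat.lt_succ_iff_lt_or_eq.1 hk with hk | rfl
    · rw [add_e_apply_of_ne y hk.ne, hxy k hk]
    · have : ∀ a b : ZMod 2, a ≠ b → a = b + 1 := by decide
      simpa [e] using this _ _ hn

lemma Cyl.add_e {α : Type*} {n j : ℕ} {g : G → α} (h : Cyl n g) (hj : n ≤ j) (x : G) :
    g (x + e j) = g x :=
  h _ _ fun _ hk => add_e_apply_of_ne x (by omega)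

/-- A pointwise description of dyadic martingales. -/
structure IsPointwiseMartingale (f : ℕ → G → ℝ) : Prop where
  cyl : ∀ n, Cyl n (f n)
  add_translate : ∀ n x, f (n + 1) x + f (n + 1) (x + e n) = 2 * f n x

/-- The martingale exceeds the level `lam` at time `i + 1` on the dyadic interval `I_i(x)`. -/
def Exceeds (f : ℕ → G → ℝ) (lam : ℝ) (i : ℕ) (x : G) : Prop :=
  lam < |f (i + 1) x| ∨ lam < |f (i + 1) (x + e i)|

/-- The (predictable) stopping time at the level `lam` is at least `n`. -/
def NotStopped (f : ℕ → G → ℝ) (lam : ℝ) (n : ℕ) (x : G) : Prop := ∀ i < n, ¬ Exceeds f lam i x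

/-- The stopping time at the level `lam` equals `n`. -/
def StopsAt (f : ℕ → G → ℝ) (lam : ℝ) (n : ℕ) (x : G) : Prop :=
  NotStopped f lam n x ∧ Exceeds f lam n x

/-- The martingale stopped at the level `lam`. -/
def stopped (f : ℕ → G → ℝ) (lam : ℝ) (n : ℕ) (x : G) : ℝ :=
  f 0 x + ∑ j ∈ Finset.range n, if NotStopped f lam (j + 1) x then f (j + 1) x - f j x else 0

section Stopping

variable {f : ℕ → G → ℝ} {lam : ℝ}

lemma notStopped_succ {n : ℕ} {x : G} :
    NotStopped f lam (n + 1) x ↔ NotStopped f lam n x ∧ ¬ Exceeds f lam n x := by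
  simp only [NotStopped, Nat.lt_succ_iff_lt_or_eq]
  exact ⟨fun h => ⟨fun i hi => h i (Or.inl hi), h n (Or.inr rfl)⟩,
    fun h i hi => hi.elim (h.1 i) fun hi => hi ▸ h.2⟩

lemma NotStopped.mono {n m : ℕ} {x : G} (h : NotStopped f lam n x) (hm : m ≤ n) :
    NotStopped f lam m x := fun i hi => h i (hi.trans_le hm)

lemma NotStopped.mono_level {lam' : ℝ} {n : ℕ} {x : G} (h : NotStopped f lam n x)
    (hl : lam ≤ lam') : NotStopped f lam' n x :=
  fun i hi hb => h i hi (hb.imp hl.trans_lt hl.trans_lt)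

lemma cyl_exceeds (hf : IsPointwiseMartingale f) (i : ℕ) : Cyl i (Exceeds f lam i) := by
  refine Cyl.of_succ (fun x y hxy => ?_) fun x => ?_
  · have h : f (i + 1) (x + e i) = f (i + 1) (y + e i) := hf.cyl _ _ _ fun k hk => by
      rw [Pi.add_apply, Pi.add_apply, hxy k hk]
    rw [Exceeds, Exceeds, hf.cyl _ x y hxy, h]
  · rw [Exceeds, Exceeds, add_e_add_e]
    exact propext or_comm

lemma cyl_notStopped_succ (hf : IsPointwiseMartingale f) (n : ℕ) :
    Cyl n (NotStopped f lam (n + 1)) := fun x y hxy => by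
  refine propext (forall₂_congr fun i hi => ?_)
  rw [(cyl_exceeds hf i).mono (Nat.lt_succ_iff.1 hi) x y hxy]

lemma cyl_notStopped (hf : IsPointwiseMartingale f) (n : ℕ) : Cyl n (NotStopped f lam n) := by
  intro x y hxy
  refine propext (forall₂_congr fun i hi => ?_)
  rw [(cyl_exceeds hf i).mono hi.le x y hxy]

lemma cyl_stopsAt (hf : IsPointwiseMartingale f) (n : ℕ) : Cyl n (StopsAt f lam n) := by
  intro x y hxy
  rw [StopsAt, StopsAt, cyl_notStopped hf n x y hxy, cyl_exceeds hf n x y hxy]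

lemma stopped_of_notStopped {n : ℕ} {x : G} (h : NotStopped f lam n x) :
    stopped f lam n x = f n x := by
  induction n with
  | zero => simp [stopped]
  | succ n ih =>
    have := ih (notStopped_succ.1 h).1
    rw [stopped] at this ⊢
    rw [Finset.sum_range_succ, ← add_assoc, this, if_pos h]
    ring

lemma abs_stopped_le {x : G} (h0 : |f 0 x| ≤ lam) (n : ℕ) : |stopped f lam n x| ≤ lam := by
  induction n with
  | zero => simpa [stopped] using h0
  | succ n ih =>
    by_cases h : NotStopped f lam (n + 1) x
    · rw [stopped_of_notStopped h]
      exact not_lt.1 fun hlt => (notStopped_succ.1 h).2 (Or.inl hlt)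
    · rwa [stopped, Finset.sum_range_succ, if_neg h, add_zero, ← stopped]

lemma sum_stopsAt (n : ℕ) (x : G) (c : ℝ) :
    ∑ j ∈ Finset.range n, (if StopsAt f lam j x then c else 0) =
      if NotStopped f lam n x then 0 else c := by
  induction n with
  | zero => simp [NotStopped]
  | succ n ih =>
    rw [Finset.sum_range_succ, ih, notStopped_succ, StopsAt]
    by_cases h1 : NotStopped f lam n x <;> by_cases h2 : Exceeds f lam n x <;> simp [h1, h2]

lemma avg_ite_diff_eq_zero (hf : IsPointwiseMartingale f) {j M : ℕ} (hj : j < M) {Q : G → Prop}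
    [DecidablePred Q] (hQ : Cyl j Q) : avg M (fun x => if Q x then f (j + 1) x - f j x else 0) = 0 := by
  have hc : Cyl M (fun x => if Q x then f (j + 1) x - f j x else 0) := fun x y hxy => by
    simp only [hQ.mono hj.le x y hxy, (hf.cyl (j + 1)).mono hj x y hxy,
      (hf.cyl j).mono hj.le x y hxy]
  have h1 := avg_translate hc (e j)
  have h2 : (fun x => if Q (x + e j) then f (j + 1) (x + e j) - f j (x + e j) else 0) =
      fun x => - (if Q x then f (j + 1) x - f j x else 0) := by
    funext x
    simp only [hQ.add_e le_rfl, (hf.cyl j).add_e le_rfl]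
    have := hf.add_translate j x
    split_ifs
    · linarith
    · simp
  rw [h2, avg_neg] at h1
  linarith

/-- The difference of two stopped martingales has mean zero where the first one stops at `n`. -/
lemma avg_stopped_sub_eq_zero (hf : IsPointwiseMartingale f) {lam' : ℝ} (hl : lam ≤ lam')
    (M n : ℕ) (z : G) :
    avg M (fun x => if x ∈ I n z then
      (if StopsAt f lam n x then stopped f lam' M x - stopped f lam M x else 0) else 0) = 0 := by
  have key : ∀ x, (if x ∈ I n z then
      (if StopsAt f lam n x then stopped f lam' M x - stopped f lam M x else 0) else 0) =
      ∑ j ∈ Finset.range M, if n ≤ j ∧ x ∈ I n z ∧ StopsAt f lam n x ∧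
        NotStopped f lam' (j + 1) x then f (j + 1) x - f j x else 0 := by
    intro x
    by_cases hz : x ∈ I n z
    · by_cases hs : StopsAt f lam n x
      · rw [if_pos hz, if_pos hs, stopped, stopped, add_sub_add_left_eq_sub,
          ← Finset.sum_sub_distrib]
        refine Finset.sum_congr rfl fun j _ => ?_
        by_cases hj : n ≤ j
        · have : ¬ NotStopped f lam (j + 1) x := fun h => h n (by omega) hs.2
          simp [this, hj, hz, hs]
        · have h1 : NotStopped f lam (j + 1) x := hs.1.mono (by omega)
          simp [h1, h1.mono_level hl, hj]
      · simp [hs]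
    · simp [hz]
  simp only [key]
  rw [avg_sum]
  refine Finset.sum_eq_zero fun j hj => ?_
  by_cases hnj : n ≤ j
  · refine avg_ite_diff_eq_zero hf (Finset.mem_range.1 hj) fun x y hxy => ?_
    have hI : x ∈ I n z ↔ y ∈ I n z :=
      forall₂_congr fun k hk => by rw [hxy k (by omega)]
    rw [hI, (cyl_stopsAt hf n).mono hnj x y hxy, cyl_notStopped_succ hf j x y hxy]
  · simp [hnj, avg_const]

end Stopping

lemma sum_indicator_I {M : ℕ} (g : G → ℝ) (x : G) :
    ∑ v : Fin M → ZMod 2, (if x ∈ I M (ext v) then g x else 0) = g x := by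
  simp [mem_I_ext_iff]

/-- The atom estimate summed over the dyadic intervals of a given generation. -/
lemma blockTotal_le_of_vanishing {p : ℝ} (hp0 : 0 < p) (hp : p < 1 / 2) {M n N : ℕ} {g : G → ℝ}
    {C : G → Prop} {c : ℝ} (hn : Nat.log 2 n < M) (hC : Cyl N C) (hgC : ∀ x, ¬ C x → g x = 0)
    (hc : ∀ x, |g x| ≤ c) (h0 : ∀ z, avg M (fun x => if x ∈ I N z then g x else 0) = 0) :
    blockTotal p M n g ≤
      atomConst (2 ^ p) * c ^ p * avg N (fun x => if C x then 1 else 0) := by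
  have hc0 : 0 ≤ c := (abs_nonneg _).trans (hc 0)
  have hat : ∀ v : Fin N → ZMod 2,
      blockTotal p M n (fun x => if x ∈ I N (ext v) then g x else 0) ≤
        atomConst (2 ^ p) * (if C (ext v) then c else 0) ^ p * (1 / 2 ^ N) := by
    intro v
    refine blockTotal_atom_le hp0 hp hn (z := ext v) (fun y hy => if_neg hy) (fun y => ?_)
      (Or.inr (h0 _))
    by_cases hy : y ∈ I N (ext v)
    · rw [if_pos hy, ← hC y (ext v) hy]
      split_ifs with h
      · exact hc y
      · simp [hgC y h]
    · rw [if_neg hy, abs_zero]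
      split_ifs <;> simp [hc0]
  calc blockTotal p M n g
      = blockTotal p M n (fun x => ∑ v : Fin N → ZMod 2, if x ∈ I N (ext v) then g x else 0) := by
        simp only [sum_indicator_I]
    _ ≤ ∑ v : Fin N → ZMod 2, atomConst (2 ^ p) * (if C (ext v) then c else 0) ^ p * (1 / 2 ^ N) :=
        (blockTotal_sum_le hp0 (by linarith) M n Finset.univ _).trans
          (Finset.sum_le_sum fun v _ => hat v)
    _ = _ := by
        rw [avg, Finset.sum_div, Finset.mul_sum]
        refine Finset.sum_congr rfl fun v _ => ?_
        split_ifs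
        · ring
        · simp [Real.zero_rpow hp0.ne']

lemma sum_ite_level_le {b d t : ℝ} (hb : 1 < b) (hd : 0 ≤ d) (ht : 0 ≤ t) (P : ℕ → Prop)
    (hP : ∀ k, P k → d * b ^ k ≤ t) (K : ℕ) :
    ∑ k ∈ Finset.range K, (if P k then d * b ^ k else 0) ≤ b / (b - 1) * t := by
  have hb1 : 0 < b - 1 := by linarith
  induction K with
  | zero => simpa using by positivity
  | succ K ih =>
    by_cases h : P K
    · calc _ ≤ ∑ k ∈ Finset.range (K + 1), d * b ^ k := Finset.sum_le_sum fun k _ => by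
            split_ifs
            · rfl
            · positivity
        _ ≤ d * (b ^ (K + 1) / (b - 1)) := by
            rw [← Finset.mul_sum]
            gcongr
            exact geom_sum_le_of_one_lt hb _
        _ = b / (b - 1) * (d * b ^ K) := by rw [pow_succ]; ring
        _ ≤ _ := by
            gcongr
            exact hP K h
    · rw [Finset.sum_range_succ, if_neg h, add_zero]
      exact ih

lemma blockTotal_stopped_sub_le {p : ℝ} (hp0 : 0 < p) (hp : p < 1 / 2) {M n : ℕ}
    {f : ℕ → G → ℝ} (hf : IsPointwiseMartingale f) (hn : Nat.log 2 n < M) {F : G → ℝ}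
    (hF : Cyl M F) (hfF : ∀ k ≤ M, ∀ x, |f k x| ≤ F x) {lam : ℝ} (h0 : ∀ x, |f 0 x| ≤ lam) :
    blockTotal p M n (fun x => stopped f (2 * lam) M x - stopped f lam M x) ≤
      2 * atomConst (2 ^ p) * (3 * lam) ^ p * avg M (fun x => if lam < F x then 1 else 0) := by
  have hlam : 0 ≤ lam := (abs_nonneg _).trans (h0 0)
  have hA := atomConst_pos hp0 hp
  set a : G → ℝ := fun x => stopped f (2 * lam) M x - stopped f lam M x with ha
  have hbound : ∀ x, |a x| ≤ 3 * lam := fun x => by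
    have h1 := abs_stopped_le (h0 x) M
    have h2 := abs_stopped_le (lam := 2 * lam) ((h0 x).trans (by linarith)) M
    exact (abs_sub _ _).trans (by linarith)
  have hdecomp : ∀ x, a x = ∑ N ∈ Finset.range M, if StopsAt f lam N x then a x else 0 := by
    intro x
    rw [sum_stopsAt]
    split_ifs with h
    · simp only [ha]
      rw [stopped_of_notStopped h, stopped_of_notStopped (h.mono_level (by linarith)), sub_self]
    · rfl
  have hpart : ∀ N ∈ Finset.range M,
      blockTotal p M n (fun x => if StopsAt f lam N x then a x else 0) ≤
      atomConst (2 ^ p) * (3 * lam) ^ p *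
        (2 * avg M (fun x => if StopsAt f lam N x then (if lam < F x then 1 else 0) else 0)) := by
    intro N hN
    have hNM := Finset.mem_range.1 hN
    have hC := cyl_stopsAt (lam := lam) hf N
    refine (blockTotal_le_of_vanishing hp0 hp hn hC (c := 3 * lam) (fun x hx => if_neg hx)
      (fun x => ?_) (avg_stopped_sub_eq_zero hf (by linarith) M N)).trans ?_
    · split_ifs
      · exact hbound x
      · simpa using hlam
    · have hC1 : Cyl N (fun x => if StopsAt f lam N x then (1 : ℝ) else 0) := fun x y hxy => by
        simp only [hC x y hxy]
      have hC2 : Cyl M (fun x => if StopsAt f lam N x then (if lam < F x then (1 : ℝ) else 0)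
          else 0) := fun x y hxy => by
        simp only [hC.mono hNM.le x y hxy, hF x y hxy]
      refine mul_le_mul_of_nonneg_left ?_ (by positivity)
      rw [hC1.avg_eq (hC1.mono hNM.le), two_mul]
      nth_rewrite 1 [← avg_translate hC2 (e N)]
      rw [← avg_add]
      refine avg_mono M fun x => ?_
      rw [hC.add_e le_rfl]
      by_cases hs : StopsAt f lam N x
      · simp only [if_pos hs]
        rcases hs.2 with h | h
        · rw [if_pos (h.trans_le (hfF _ hNM x))]
          split_ifs <;> norm_num
        · rw [if_pos (h.trans_le (hfF _ hNM _))]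
          split_ifs <;> norm_num
      · simp [hs]
  calc blockTotal p M n a
      = blockTotal p M n (fun x => ∑ N ∈ Finset.range M, if StopsAt f lam N x then a x else 0) := by
        rw [← funext hdecomp]
    _ ≤ ∑ N ∈ Finset.range M, atomConst (2 ^ p) * (3 * lam) ^ p *
        (2 * avg M (fun x => if StopsAt f lam N x then (if lam < F x then 1 else 0) else 0)) :=
        (blockTotal_sum_le hp0 (by linarith) M n _ _).trans (Finset.sum_le_sum hpart)
    _ = 2 * atomConst (2 ^ p) * (3 * lam) ^ p * avg M (fun x => ∑ N ∈ Finset.range M,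
        if StopsAt f lam N x then (if lam < F x then 1 else 0) else 0) := by
        rw [avg_sum, Finset.mul_sum]
        exact Finset.sum_congr rfl fun _ _ => by ring
    _ ≤ _ := by
        refine mul_le_mul_of_nonneg_left (avg_mono M fun x => ?_) (by positivity)
        rw [sum_stopsAt]
        split_ifs <;> norm_num

lemma Cyl.le_two_pow_mul_avg {M : ℕ} {g : G → ℝ} (h : Cyl M g) (h0 : ∀ x, 0 ≤ g x) (x : G) :
    g x ≤ 2 ^ M * avg M g := by
  rw [avg, mul_div_cancel₀ _ (by positivity), ← h.ext_restr x]
  exact Finset.single_le_sum (f := fun v => g (ext v)) (fun v _ => h0 _) (Finset.mem_univ _)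

/-- The constant in the estimate of `blockTotal` on martingales. -/
def martConst (p : ℝ) : ℝ :=
  atomConst (2 ^ p) + 2 * atomConst (2 ^ p) * 3 ^ p * ((2 : ℝ) ^ p / (2 ^ p - 1))

theorem blockTotal_martingale_le {p : ℝ} (hp0 : 0 < p) (hp : p < 1 / 2) {M n : ℕ}
    {f : ℕ → G → ℝ} (hf : IsPointwiseMartingale f) (hn : Nat.log 2 n < M) {F : G → ℝ}
    (hF : Cyl M F) (hfF : ∀ k ≤ M, ∀ x, |f k x| ≤ F x) :
    blockTotal p M n (f M) ≤ martConst p * avg M (fun x => F x ^ p) := by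
  have hA := atomConst_pos hp0 hp
  have hb := one_lt_two_rpow hp0
  have hF0 : ∀ x, 0 ≤ F x := fun x => (abs_nonneg _).trans (hfF 0 (Nat.zero_le _) x)
  set E := avg M (fun x => F x ^ p) with hE
  have hE0 : 0 ≤ E := avg_nonneg M fun x => Real.rpow_nonneg (hF0 x) p
  set δ := E ^ (1 / p) with hδ
  have hδ0 : 0 ≤ δ := Real.rpow_nonneg hE0 _
  have hδp : δ ^ p = E := by
    rw [hδ, ← Real.rpow_mul hE0, one_div_mul_cancel hp0.ne', Real.rpow_one]
  have hf0 : ∀ x, |f 0 x| ≤ δ := by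
    intro x
    rw [← Real.rpow_le_rpow_iff (abs_nonneg _) hδ0 hp0, hδp, ← avg_const M (|f 0 x| ^ p)]
    refine avg_mono M fun y => Real.rpow_le_rpow (abs_nonneg _) ?_ hp0.le
    rw [hf.cyl 0 x y fun k hk => absurd hk (Nat.not_lt_zero k)]
    exact hfF 0 (Nat.zero_le _) y
  have hfl : ∀ k : ℕ, ∀ x, |f 0 x| ≤ δ * 2 ^ k := fun k x =>
    (hf0 x).trans (le_mul_of_one_le_right hδ0 (one_le_pow₀ (by norm_num)))
  obtain ⟨K, hK⟩ := pow_unbounded_of_one_lt (((2 : ℝ) ^ M) ^ (1 / p)) (one_lt_two)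
  have hFK : ∀ x, F x ≤ δ * 2 ^ K := by
    intro x
    have hcyl : Cyl M (fun x => F x ^ p) := fun x y hxy => by simp only [hF x y hxy]
    have h1 := hcyl.le_two_pow_mul_avg (fun x => Real.rpow_nonneg (hF0 x) p) x
    have h2 : F x ≤ δ * ((2 : ℝ) ^ M) ^ (1 / p) := by
      rw [← Real.rpow_le_rpow_iff (hF0 x) (by positivity) hp0,
        Real.mul_rpow hδ0 (by positivity), hδp, ← Real.rpow_mul (by positivity),
        one_div_mul_cancel hp0.ne', Real.rpow_one, mul_comm]
      exact h1
    exact h2.trans (by gcongr)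
  have htel : ∀ x, f M x = stopped f δ M x + ∑ k ∈ Finset.range K,
      (stopped f (2 * (δ * 2 ^ k)) M x - stopped f (δ * 2 ^ k) M x) := by
    intro x
    have h1 : NotStopped f (δ * 2 ^ K) M x := by
      intro i hi h
      rcases h with h | h
      · exact absurd ((hfF _ hi x).trans (hFK x)) (not_le.2 h)
      · exact absurd ((hfF _ hi _).trans (hFK _)) (not_le.2 h)
    have h2 : ∀ k : ℕ, 2 * (δ * 2 ^ k) = δ * 2 ^ (k + 1) := fun k => by rw [pow_succ]; ring
    simp only [h2]
    rw [Finset.sum_range_sub (fun k => stopped f (δ * 2 ^ k) M x), stopped_of_notStopped h1]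
    simp
  have hlev : ∀ k : ℕ, (3 * (δ * 2 ^ k)) ^ p = 3 ^ p * (E * (2 ^ p) ^ k) := fun k => by
    rw [Real.mul_rpow (by norm_num) (by positivity), Real.mul_rpow hδ0 (by positivity), hδp,
      two_pow_rpow]
  have hfirst : blockTotal p M n (stopped f δ M) ≤ atomConst (2 ^ p) * E := by
    have := blockTotal_atom_le hp0 hp hn (N := 0) (z := 0) (g := stopped f δ M) (c := δ)
      (fun y hy => absurd (fun k hk => absurd hk (Nat.not_lt_zero k)) hy)
      (fun y => abs_stopped_le (hf0 y) M) (Or.inl rfl)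
    simpa [hδp] using this
  calc blockTotal p M n (f M)
      = blockTotal p M n (fun x => stopped f δ M x + ∑ k ∈ Finset.range K,
        (stopped f (2 * (δ * 2 ^ k)) M x - stopped f (δ * 2 ^ k) M x)) := by rw [← funext htel]
    _ ≤ atomConst (2 ^ p) * E + ∑ k ∈ Finset.range K, 2 * atomConst (2 ^ p) *
        (3 * (δ * 2 ^ k)) ^ p * avg M (fun x => if δ * 2 ^ k < F x then 1 else 0) := by
        refine (blockTotal_add_le hp0 (by linarith) M n _ _).trans (add_le_add hfirst ?_)
        exact (blockTotal_sum_le hp0 (by linarith) M n _ _).trans (Finset.sum_le_sum fun k _ =>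
          blockTotal_stopped_sub_le hp0 hp hf hn hF hfF (hfl k))
    _ = atomConst (2 ^ p) * E + 2 * atomConst (2 ^ p) * 3 ^ p * avg M (fun x =>
        ∑ k ∈ Finset.range K, if δ * 2 ^ k < F x then E * (2 ^ p) ^ k else 0) := by
        rw [avg_sum, Finset.mul_sum]
        congr 1
        refine Finset.sum_congr rfl fun k _ => ?_
        have : avg M (fun x => if δ * 2 ^ k < F x then E * (2 ^ p) ^ k else 0) =
            E * (2 ^ p) ^ k * avg M (fun x => if δ * 2 ^ k < F x then 1 else 0) := by
          rw [← avg_const_mul]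
          simp only [mul_ite, mul_one, mul_zero]
        rw [hlev, this]
        ring
    _ ≤ atomConst (2 ^ p) * E + 2 * atomConst (2 ^ p) * 3 ^ p * avg M (fun x =>
        (2 : ℝ) ^ p / (2 ^ p - 1) * F x ^ p) := by
        gcongr
        refine avg_mono M fun x => ?_
        refine sum_ite_level_le hb hE0 (Real.rpow_nonneg (hF0 x) p) _ (fun k hk => ?_) K
        rw [← hδp, ← two_pow_rpow, ← Real.mul_rpow hδ0 (by positivity)]
        exact Real.rpow_le_rpow (by positivity) hk.le hp0.le
    _ = _ := by
        rw [avg_const_mul, ← hE, martConst]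
        ring

lemma mem_iff_of_measurableSet_F {n : ℕ} {s : Set G} (hs : MeasurableSet[F n] s) {x y : G}
    (hxy : ∀ k < n, x k = y k) : x ∈ s ↔ y ∈ s := by
  induction s, hs using MeasurableSpace.generateFrom_induction with
  | hC t ht _ =>
    obtain ⟨z, rfl⟩ := ht
    exact forall₂_congr fun k hk => by rw [hxy k hk]
  | empty => rfl
  | compl t _ ih => exact not_congr ih
  | iUnion t _ ih =>
    simp only [Set.mem_iUnion]
    exact exists_congr ih

lemma cyl_of_stronglyMeasurable {n : ℕ} {g : G → ℝ} (h : StronglyMeasurable[F n] g) :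
    Cyl n g := by
  intro x y hxy
  have hs : MeasurableSet[F n] (g ⁻¹' {g y}) := h.measurable (measurableSet_singleton _)
  exact (mem_iff_of_measurableSet_F hs hxy).2 rfl

lemma Cyl.setIntegral_I {n : ℕ} {g : G → ℝ} (h : Cyl n g) (x : G) :
    ∫ y in I n x, g y ∂μG = g x / 2 ^ n := by
  rw [setIntegral_congr_fun (measurableSet_I n x) (g := fun _ => g x) fun y hy => h y x hy,
    setIntegral_const, measureReal_def, μG_I, ENNReal.toReal_ofReal (by positivity), smul_eq_mul]
  ring

lemma F_le (n : ℕ) : F n ≤ (inferInstance : MeasurableSpace G) :=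
  MeasurableSpace.generateFrom_le fun s hs => by
    obtain ⟨x, rfl⟩ := hs
    exact measurableSet_I n x

lemma I_eq_union (n : ℕ) (x : G) : I n x = I (n + 1) x ∪ I (n + 1) (x + e n) := by
  ext y
  have h : y ∈ I n (x + e n) ↔ y ∈ I n x :=
    forall₂_congr fun k hk => by rw [add_e_apply_of_ne x hk.ne]
  rw [Set.mem_union, mem_I_succ_iff, mem_I_succ_iff, h, ← and_or_left]
  have : ∀ a b : ZMod 2, a = b ∨ a = b + 1 := by decide
  simpa [e] using fun _ => this (y n) (x n)

lemma IsDyadicMartingale.isPointwiseMartingale {f : ℕ → G → ℝ} (hf : IsDyadicMartingale f) :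
    IsPointwiseMartingale f := by
  obtain ⟨hi, hm, hc⟩ := hf
  have hcyl : ∀ n, Cyl n (f n) := fun n => cyl_of_stronglyMeasurable (hm n)
  refine ⟨hcyl, fun n x => ?_⟩
  have hI : MeasurableSet[F n] (I n x) := MeasurableSpace.measurableSet_generateFrom ⟨x, rfl⟩
  have h1 : ∫ y in I n x, f (n + 1) y ∂μG = ∫ y in I n x, f n y ∂μG := by
    rw [← setIntegral_condExp (F_le n) (hi (n + 1)) hI]
    exact setIntegral_congr_ae (measurableSet_I n x) ((hc n).mono fun y hy _ => hy)
  have hdisj : Disjoint (I (n + 1) x) (I (n + 1) (x + e n)) := by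
    rw [Set.disjoint_left]
    intro y h h'
    have h2 := (h n (Nat.lt_succ_self n)).symm.trans (h' n (Nat.lt_succ_self n))
    simp [e] at h2
  rw [(hcyl n).setIntegral_I, I_eq_union, setIntegral_union hdisj (measurableSet_I _ _)
    (hi _).integrableOn (hi _).integrableOn, (hcyl _).setIntegral_I, (hcyl _).setIntegral_I,
    pow_succ] at h1
  field_simp at h1
  linarith

lemma Cyl.mul {n : ℕ} {g h : G → ℝ} (hg : Cyl n g) (hh : Cyl n h) : Cyl n (fun x => g x * h x) :=
  fun x y hxy => by simp only [hg x y hxy, hh x y hxy]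

lemma IsPointwiseMartingale.avg_mul_eq {f : ℕ → G → ℝ} (hf : IsPointwiseMartingale f) {k M : ℕ}
    (hk : k ≤ M) {g : G → ℝ} (hg : Cyl k g) :
    avg M (fun x => f M x * g x) = avg k (fun x => f k x * g x) := by
  induction M, hk using Nat.le_induction with
  | base => rfl
  | succ M hM ih =>
    rw [← ih]
    have hgM := hg.mono hM
    have h1 := avg_translate ((hf.cyl (M + 1)).mul (hgM.mono (Nat.le_succ M))) (e M)
    have h2 : (fun x => f (M + 1) x * g x + f (M + 1) (x + e M) * g (x + e M)) =
        fun x => 2 * (f M x * g x) := by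
      funext x
      rw [hgM.add_e le_rfl, ← add_mul, hf.add_translate]
      ring
    have h3 := avg_add (M + 1) (fun x => f (M + 1) x * g x)
      (fun x => f (M + 1) (x + e M) * g (x + e M))
    have hM' := (hf.cyl M).mul hgM
    rw [h2, avg_const_mul, h1, (hM'.mono (Nat.le_succ M)).avg_eq hM'] at h3
    linarith

lemma IsPointwiseMartingale.martCoeffK_eq {f : ℕ → G → ℝ} (hf : IsPointwiseMartingale f)
    {i M : ℕ} (hi : i < 2 ^ M) : martCoeffK f i = avg M (fun x => f M x * kacz i x) := by
  refine Tendsto.limUnder_eq (tendsto_const_nhds.congr' ?_)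
  filter_upwards [eventually_ge_atTop M] with k hk
  rw [((hf.cyl k).mul ((cyl_kacz hi).mono hk)).integral_eq, hf.avg_mul_eq hk (cyl_kacz hi)]

lemma IsPointwiseMartingale.sum_martCoeffK {f : ℕ → G → ℝ} (hf : IsPointwiseMartingale f)
    {M : ℕ} (s : Finset ℕ) (hs : ∀ k ∈ s, k < 2 ^ M) (x : G) :
    ∑ k ∈ s, martCoeffK f k * kacz k x =
      avg M (fun y => f M y * ∑ k ∈ s, kacz k (x + y)) := by
  simp only [Finset.mul_sum]
  rw [avg_sum]
  refine Finset.sum_congr rfl fun k hk => ?_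
  rw [hf.martCoeffK_eq (hs k hk), mul_comm, ← avg_const_mul]
  simp only [kacz_add]
  congr 1
  funext y
  ring

lemma add_mem_I_zero_iff (n : ℕ) (x y : G) : x + y ∈ I n 0 ↔ y ∈ I n x := by
  have : ∀ a b : ZMod 2, a + b = 0 ↔ b = a := by decide
  exact forall₂_congr fun k _ => this (x k) (y k)

lemma IsPointwiseMartingale.martSK_two_pow {f : ℕ → G → ℝ} (hf : IsPointwiseMartingale f)
    (n : ℕ) (x : G) : martSK f (2 ^ n) x = f n x := by
  rw [martSK, hf.sum_martCoeffK (M := n) _ fun k hk => Finset.mem_range.1 hk]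
  have : ∀ y, f n y * ∑ k ∈ Finset.range (2 ^ n), kacz k (x + y) =
      2 ^ n * (if y ∈ I n x then f n x else 0) := by
    intro y
    have := dirK_two_pow n (x + y)
    rw [dirK] at this
    rw [this, add_mem_I_zero_iff]
    split_ifs with h
    · rw [hf.cyl n y x h, mul_comm]
    · simp
  simp only [this]
  rw [avg_const_mul, avg, mul_div_cancel₀ _ (by positivity)]
  have h2 : ∀ v : Fin n → ZMod 2, ext v ∈ I n x ↔ v = restr n x := by
    intro v
    rw [← mem_I_ext_iff]
    exact forall₂_congr fun k _ => eq_comm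
  simp [h2]

lemma IsPointwiseMartingale.martSK_two_pow_add {f : ℕ → G → ℝ} (hf : IsPointwiseMartingale f)
    {i r M : ℕ} (hr : r ≤ 2 ^ i) (hi : i < M) (x : G) :
    martSK f (2 ^ i + r) x = f i x +
      avg M (fun y => f M y * (rademacher i (x + y) * dirW r (tau i (x + y)))) := by
  have h2 : 2 ^ (i + 1) ≤ 2 ^ M := Nat.pow_le_pow_right (by norm_num) hi
  rw [pow_succ] at h2
  rw [martSK, Finset.sum_range_add, ← martSK, hf.martSK_two_pow,
    ← Finset.sum_image (g := fun l => 2 ^ i + l) (s := Finset.range r)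
      (f := fun k => martCoeffK f k * kacz k x) (fun a _ b _ h => by simpa using h),
    hf.sum_martCoeffK (M := M)]
  · congr 2
    funext y
    rw [Finset.sum_image (fun a _ b _ h => by simpa using h), sum_kacz_block hr]
  · intro k hk
    obtain ⟨l, hl, rfl⟩ := Finset.mem_image.1 hk
    have := Finset.mem_range.1 hl
    omega

lemma IsPointwiseMartingale.sum_martSK_block {f : ℕ → G → ℝ} (hf : IsPointwiseMartingale f)
    {i R M : ℕ} (hR : R ≤ 2 ^ i) (hi : i < M) (x : G) :
    ∑ r ∈ Finset.range R, martSK f (2 ^ i + r) x = R * f i x + blockConv M i R (f M) x := by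
  rw [Finset.sum_congr rfl fun r hr =>
    hf.martSK_two_pow_add ((Finset.mem_range.1 hr).le.trans hR) hi x, Finset.sum_add_distrib,
    Finset.sum_const, Finset.card_range, nsmul_eq_mul, ← avg_sum, blockConv]
  simp only [dirWSum, Finset.mul_sum]

lemma sum_Icc_blocks (m : ℕ) (φ : ℕ → ℝ) :
    ∑ j ∈ Finset.Icc 1 m, φ j =
      ∑ i ∈ Finset.range (Nat.log 2 m + 1), ∑ r ∈ Finset.range (blockLen m i), φ (2 ^ i + r) := by
  rw [← Finset.sum_fiberwise_of_maps_to (s := Finset.Icc 1 m)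
    (t := Finset.range (Nat.log 2 m + 1)) (g := Nat.log 2) (by
      intro j hj
      rw [Finset.mem_range, Nat.lt_succ_iff]
      exact Nat.log_mono_right (Finset.mem_Icc.1 hj).2)]
  refine Finset.sum_congr rfl fun i _ => ?_
  have h1 : (Finset.Icc 1 m).filter (fun j => Nat.log 2 j = i) =
      Finset.Ico (2 ^ i) (min (2 ^ (i + 1)) (m + 1)) := by
    ext j
    have hpos : 0 < 2 ^ i := by positivity
    simp only [Finset.mem_filter, Finset.mem_Icc, Finset.mem_Ico, lt_min_iff]
    constructor
    · rintro ⟨⟨hj1, hj2⟩, hl⟩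
      have := (Nat.log_eq_iff (Or.inr ⟨by norm_num, by omega⟩)).1 hl
      omega
    · rintro ⟨hj1, hj2, hj3⟩
      exact ⟨by omega, (Nat.log_eq_iff (Or.inr ⟨by norm_num, by omega⟩)).2 ⟨hj1, hj2⟩⟩
  have h2 : min (2 ^ (i + 1)) (m + 1) - 2 ^ i = blockLen m i := by
    rw [blockLen, pow_succ]
    omega
  rw [h1, Finset.sum_Ico_eq_sum_range, h2]

lemma setIntegral_kacz_eq_zero {n k : ℕ} (hk : 2 ^ n ≤ k) (x : G) :
    ∫ y in I n x, kacz k y ∂μG = 0 := by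
  have hpos : 0 < 2 ^ n := by positivity
  obtain ⟨i, l, hl, rfl⟩ := exists_two_pow_add (n := k) (by omega)
  have hni : n ≤ i := by
    have : 2 ^ n < 2 ^ (i + 1) := by rw [pow_succ]; omega
    exact Nat.lt_succ_iff.1 ((Nat.pow_lt_pow_iff_right (a := 2) (by norm_num)).1 this)
  have hneg : ∀ y, kacz (2 ^ i + l) (y + e i) = - kacz (2 ^ i + l) y := by
    intro y
    have hw : walsh l (tau i (e i)) = 1 := by
      rw [cyl_walsh hl _ 0 fun k hk => by simp [tau, e, hk]; omega]
      simp [walsh, rademacher]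
    have hr : rademacher i (e i) = -1 := by
      rw [rademacher_eq]
      simp [e]
    rw [kacz_add, kacz_two_pow_add hl (e i), hw, hr]
    ring
  have hc : Cyl (i + 1) (fun y => if y ∈ I n x then kacz (2 ^ i + l) y else 0) := by
    intro y z hyz
    have h1 : y ∈ I n x ↔ z ∈ I n x := forall₂_congr fun k hk => by rw [hyz k (by omega)]
    have h2 : 2 ^ i + l < 2 ^ (i + 1) := by rw [pow_succ]; omega
    simp only [h1, cyl_kacz h2 y z hyz]
  have ht := avg_translate hc (e i)
  have h2 : (fun y => if y + e i ∈ I n x then kacz (2 ^ i + l) (y + e i) else 0) =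
      fun y => - (if y ∈ I n x then kacz (2 ^ i + l) y else 0) := by
    funext y
    have h1 : y + e i ∈ I n x ↔ y ∈ I n x :=
      forall₂_congr fun k hk => by rw [add_e_apply_of_ne y (by omega)]
    simp only [h1, hneg]
    split_ifs <;> simp
  rw [h2, avg_neg] at ht
  rw [← integral_indicator (measurableSet_I n x)]
  have h3 : (I n x).indicator (kacz (2 ^ i + l)) =
      fun y => if y ∈ I n x then kacz (2 ^ i + l) y else 0 := by
    funext y
    simp [Set.indicator]
  rw [h3, hc.integral_eq]
  linarith

lemma integrable_kacz (k : ℕ) : Integrable (kacz k) μG := (cyl_kacz Nat.lt_two_pow_self).integrable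

lemma integrable_martSK (f : ℕ → G → ℝ) (j : ℕ) : Integrable (martSK f j) μG := by
  unfold martSK
  exact integrable_finsetSum _ fun k _ => (integrable_kacz k).const_mul _

lemma setIntegral_martSK (f : ℕ → G → ℝ) (j n : ℕ) (x : G) :
    ∫ y in I n x, martSK f j y ∂μG = martSK f (min j (2 ^ n)) x / 2 ^ n := by
  simp only [martSK]
  rw [integral_finsetSum _ fun k _ => ((integrable_kacz k).const_mul _).integrableOn,
    Finset.sum_div]
  have h : ∀ k, ∫ y in I n x, martCoeffK f k * kacz k y ∂μG =
      if k < 2 ^ n then martCoeffK f k * kacz k x / 2 ^ n else 0 := by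
    intro k
    rw [integral_const_mul]
    split_ifs with hk
    · rw [(cyl_kacz hk).setIntegral_I, mul_div_assoc]
    · rw [setIntegral_kacz_eq_zero (not_lt.1 hk), mul_zero]
  simp only [h]
  rw [← Finset.sum_filter]
  congr 1
  ext k
  simp

lemma setIntegral_martSigmaK (f : ℕ → G → ℝ) (m n : ℕ) (x : G) :
    ∫ y in I n x, martSigmaK f m y ∂μG =
      1 / (m : ℝ) * (∑ j ∈ Finset.Icc 1 m, martSK f (min j (2 ^ n)) x) / 2 ^ n := by
  simp only [martSigmaK]
  rw [integral_const_mul, integral_finsetSum _ fun j _ => (integrable_martSK f j).integrableOn]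
  simp only [setIntegral_martSK]
  rw [← Finset.sum_div, mul_div_assoc]
  congr 2
  rw [Finset.sum_range_succ', ← Finset.Ico_add_one_right_eq_Icc, Finset.sum_Ico_eq_sum_range]
  simp [martSK, add_comm]

/-- The maximal function of a martingale up to time `M`. -/
def maxUpTo (f : ℕ → G → ℝ) (M : ℕ) (x : G) : ℝ :=
  (Finset.range (M + 1)).sup' Finset.nonempty_range_add_one fun k => |f k x|

lemma abs_le_maxUpTo (f : ℕ → G → ℝ) {k M : ℕ} (h : k ≤ M) (x : G) : |f k x| ≤ maxUpTo f M x :=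
  Finset.le_sup' (fun k => |f k x|) (Finset.mem_range.2 (Nat.lt_succ_iff.2 h))

lemma maxUpTo_nonneg (f : ℕ → G → ℝ) (M : ℕ) (x : G) : 0 ≤ maxUpTo f M x :=
  (abs_nonneg _).trans (abs_le_maxUpTo f (Nat.zero_le M) x)

lemma cyl_maxUpTo {f : ℕ → G → ℝ} (hf : IsPointwiseMartingale f) (M : ℕ) : Cyl M (maxUpTo f M) := by
  intro x y hxy
  refine Finset.sup'_congr _ rfl fun k hk => ?_
  rw [(hf.cyl k).mono (Nat.lt_succ_iff.1 (Finset.mem_range.1 hk)) x y hxy]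

lemma ofReal_avg_maxUpTo_le {p : ℝ} (hp0 : 0 < p) {f : ℕ → G → ℝ}
    (hf : IsPointwiseMartingale f) (M : ℕ) :
    ENNReal.ofReal (avg M (fun x => maxUpTo f M x ^ p)) ≤ martHpNormP p f := by
  have hc : Cyl M (fun x => maxUpTo f M x ^ p) := fun x y hxy => by
    simp only [cyl_maxUpTo hf M x y hxy]
  rw [← hc.lintegral_eq fun x => Real.rpow_nonneg (maxUpTo_nonneg f M x) p]
  refine lintegral_mono fun x => ?_
  rw [← ENNReal.ofReal_rpow_of_nonneg (maxUpTo_nonneg f M x) hp0.le]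
  refine ENNReal.rpow_le_rpow ?_ hp0.le
  obtain ⟨k, _, hk⟩ := Finset.exists_mem_eq_sup' (s := Finset.range (M + 1))
    Finset.nonempty_range_add_one fun k => |f k x|
  rw [maxUpTo, hk]
  exact le_iSup (fun n => ENNReal.ofReal |f n x|) k

lemma abs_sum_martSK_le {f : ℕ → G → ℝ} (hf : IsPointwiseMartingale f) {m M : ℕ}
    (hm : Nat.log 2 m < M) (n : ℕ) (x : G) :
    |∑ j ∈ Finset.Icc 1 m, martSK f (min j (2 ^ n)) x| ≤ m * maxUpTo f M x +
      ∑ i ∈ Finset.range (Nat.log 2 m + 1), |blockConv M i (blockLen m i) (f M) x| := by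
  have hcard : (m : ℝ) = ∑ i ∈ Finset.range (Nat.log 2 m + 1), (blockLen m i : ℝ) := by
    have := sum_Icc_blocks m fun _ => 1
    simpa using this
  rw [sum_Icc_blocks, hcard, Finset.sum_mul, ← Finset.sum_add_distrib]
  refine (Finset.abs_sum_le_sum_abs _ _).trans (Finset.sum_le_sum fun i hi => ?_)
  have hiM : i < M := by have := Finset.mem_range.1 hi; omega
  have hlen := blockLen_le m i
  by_cases hin : i < n
  · have hpow : 2 ^ (i + 1) ≤ 2 ^ n := Nat.pow_le_pow_right (by norm_num) hin
    rw [pow_succ] at hpow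
    rw [Finset.sum_congr rfl fun r hr => by
      rw [min_eq_left (by have := Finset.mem_range.1 hr; omega : 2 ^ i + r ≤ 2 ^ n)],
      hf.sum_martSK_block hlen hiM]
    refine (abs_add_le _ _).trans ?_
    rw [abs_mul, Nat.abs_cast]
    gcongr
    exact abs_le_maxUpTo f hiM.le x
  · have hpow : 2 ^ n ≤ 2 ^ i := Nat.pow_le_pow_right (by norm_num) (not_lt.1 hin)
    rw [Finset.sum_congr rfl fun r _ => by
      rw [min_eq_right (by omega : 2 ^ n ≤ 2 ^ i + r), hf.martSK_two_pow], Finset.sum_const,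
      Finset.card_range, nsmul_eq_mul, abs_mul, Nat.abs_cast]
    refine le_add_of_le_of_nonneg ?_ (abs_nonneg _)
    gcongr
    exact abs_le_maxUpTo f (by omega) x

lemma funMaximal_martSigmaK_le {f : ℕ → G → ℝ} (hf : IsPointwiseMartingale f) {m M : ℕ}
    (hm1 : 1 ≤ m) (hm : Nat.log 2 m < M) (x : G) :
    funMaximal (martSigmaK f m) x ≤ ENNReal.ofReal (maxUpTo f M x + 1 / m *
      ∑ i ∈ Finset.range (Nat.log 2 m + 1), |blockConv M i (blockLen m i) (f M) x|) := by
  have hm0 : (0 : ℝ) < m := by exact_mod_cast hm1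
  refine iSup_le fun n => ?_
  rw [μG_I, ← ENNReal.ofReal_div_of_pos (by positivity), setIntegral_martSigmaK]
  refine ENNReal.ofReal_le_ofReal ?_
  have h := abs_sum_martSK_le hf hm n x
  rw [abs_div, abs_mul, abs_of_pos (by positivity : (0 : ℝ) < 1 / m),
    abs_of_pos (by positivity : (0 : ℝ) < 2 ^ n)]
  calc _ = 1 / (m : ℝ) * |∑ j ∈ Finset.Icc 1 m, martSK f (min j (2 ^ n)) x| := by field_simp
    _ ≤ 1 / (m : ℝ) * (m * maxUpTo f M x +
        ∑ i ∈ Finset.range (Nat.log 2 m + 1), |blockConv M i (blockLen m i) (f M) x|) := by gcongr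
    _ = _ := by field_simp

lemma cyl_blockConv {M i R : ℕ} (hR : R ≤ 2 ^ i) (hi : i < M) (g : G → ℝ) :
    Cyl M (blockConv M i R g) := by
  intro x y hxy
  unfold blockConv
  congr 1
  funext z
  have := cyl_blockKernel hR hi (x + z) (y + z) fun k hk => by
    rw [Pi.add_apply, Pi.add_apply, hxy k hk]
  simp only at this
  rw [this]

lemma funHpNormP_martSigmaK_le {p : ℝ} (hp0 : 0 < p) (hp1 : p ≤ 1) {f : ℕ → G → ℝ}
    (hf : IsPointwiseMartingale f) {m M : ℕ} (hm1 : 1 ≤ m) (hm : Nat.log 2 m < M) :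
    funHpNormP p (martSigmaK f m) ≤ ENNReal.ofReal (avg M (fun x => maxUpTo f M x ^ p) +
      1 / (m : ℝ) ^ p * ∑ i ∈ Finset.range (Nat.log 2 m + 1),
        avg M (fun x => |blockConv M i (blockLen m i) (f M) x| ^ p)) := by
  set g : G → ℝ := fun x => maxUpTo f M x ^ p + 1 / (m : ℝ) ^ p *
    ∑ i ∈ Finset.range (Nat.log 2 m + 1), |blockConv M i (blockLen m i) (f M) x| ^ p with hg
  have hg0 : ∀ x, 0 ≤ g x := fun x => by
    have := maxUpTo_nonneg f M x
    simp only [hg]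
    positivity
  have hgc : Cyl M g := by
    intro x y hxy
    simp only [hg, cyl_maxUpTo hf M x y hxy]
    congr 2
    refine Finset.sum_congr rfl fun i hi => ?_
    have hiM : i < M := by have := Finset.mem_range.1 hi; omega
    rw [cyl_blockConv (blockLen_le m i) hiM _ x y hxy]
  have havg : avg M g = avg M (fun x => maxUpTo f M x ^ p) +
      1 / (m : ℝ) ^ p * ∑ i ∈ Finset.range (Nat.log 2 m + 1),
        avg M (fun x => |blockConv M i (blockLen m i) (f M) x| ^ p) := by
    rw [hg, avg_add, avg_const_mul, avg_sum]
  rw [← havg, ← hgc.lintegral_eq hg0]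
  refine lintegral_mono fun x => ?_
  have hF := maxUpTo_nonneg f M x
  have hB : 0 ≤ ∑ i ∈ Finset.range (Nat.log 2 m + 1), |blockConv M i (blockLen m i) (f M) x| :=
    Finset.sum_nonneg fun _ _ => abs_nonneg _
  refine (ENNReal.rpow_le_rpow (funMaximal_martSigmaK_le hf hm1 hm x) hp0.le).trans ?_
  rw [ENNReal.ofReal_rpow_of_nonneg (by positivity) hp0.le]
  refine ENNReal.ofReal_le_ofReal ?_
  refine (rpow_add_le_add_rpow hp0.le hp1 hF (by positivity)).trans ?_
  rw [Real.mul_rpow (by positivity) hB, Real.div_rpow zero_le_one (by positivity),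
    Real.one_rpow]
  simp only [hg]
  gcongr
  exact rpow_sum_le_sum_rpow hp0 hp1 _ fun _ _ => abs_nonneg _

lemma sum_one_div_rpow_le {p : ℝ} (hp : p < 1 / 2) (n : ℕ) :
    ∑ m ∈ Finset.Icc 1 n, 1 / (m : ℝ) ^ (2 - 2 * p) ≤ 1 / (1 - ((2 : ℝ) ^ p) ^ 2 / 2) := by
  calc _ ≤ ∑ m ∈ Finset.Icc 1 n, (((2 : ℝ) ^ p) ^ 2 / 4) ^ Nat.log 2 m := by
        refine Finset.sum_le_sum fun m hm => ?_
        refine (one_div_natCast_rpow_le (by linarith) (Finset.mem_Icc.1 hm).1).trans_eq ?_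
        rw [two_pow_rpow_two_sub, one_div_div, div_pow]
    _ ≤ ∑ A ∈ Finset.range (Nat.log 2 n + 1), 2 ^ A * (((2 : ℝ) ^ p) ^ 2 / 4) ^ A :=
        sum_Icc_log_le n (h := fun A => (((2 : ℝ) ^ p) ^ 2 / 4) ^ A) fun A => by positivity
    _ = ∑ A ∈ Finset.range (Nat.log 2 n + 1), (((2 : ℝ) ^ p) ^ 2 / 2) ^ A := by
        refine Finset.sum_congr rfl fun A _ => ?_
        rw [← mul_pow]
        congr 1
        ring
    _ ≤ _ := geom_sum_le_of_lt_one (by positivity) (two_rpow_sq_div_two_lt_one hp) _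

lemma martConst_pos {p : ℝ} (hp0 : 0 < p) (hp : p < 1 / 2) : 0 < martConst p := by
  have h0 := atomConst_pos hp0 hp
  have h1 : (0 : ℝ) < 2 ^ p - 1 := sub_pos.2 (one_lt_two_rpow hp0)
  unfold martConst
  positivity

/-- The weighted sum of the norms, with the martingale truncated at a finite time `M`. -/
lemma sum_funHpNormP_le {p : ℝ} (hp0 : 0 < p) (hp : p < 1 / 2) {f : ℕ → G → ℝ}
    (hf : IsPointwiseMartingale f) {n M : ℕ} (hM : Nat.log 2 n < M) :
    ∑ m ∈ Finset.Icc 1 n, funHpNormP p (martSigmaK f m) / (m : ℝ≥0∞) ^ (2 - 2 * p) ≤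
      ENNReal.ofReal (avg M (fun x => maxUpTo f M x ^ p) *
        ∑ m ∈ Finset.Icc 1 n, 1 / (m : ℝ) ^ (2 - 2 * p) + blockTotal p M n (f M)) := by
  have hE0 : 0 ≤ avg M (fun x => maxUpTo f M x ^ p) :=
    avg_nonneg M fun x => Real.rpow_nonneg (maxUpTo_nonneg f M x) p
  rw [blockTotal, Finset.mul_sum, ← Finset.sum_add_distrib, ENNReal.ofReal_sum_of_nonneg]
  · refine Finset.sum_le_sum fun m hm => ?_
    obtain ⟨hm1, hmn⟩ := Finset.mem_Icc.1 hm
    have hm0 : (0 : ℝ) < m := by exact_mod_cast hm1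
    refine (ENNReal.div_le_div_right (funHpNormP_martSigmaK_le hp0 (by linarith) hf hm1
      ((Nat.log_mono_right hmn).trans_lt hM)) _).trans_eq ?_
    rw [← ENNReal.ofReal_natCast, ENNReal.ofReal_rpow_of_pos hm0,
      ← ENNReal.ofReal_div_of_pos (by positivity), ← one_div_mul_one_div]
    congr 1
    ring
  · intro m _
    have hB0 : 0 ≤ ∑ i ∈ Finset.range (Nat.log 2 m + 1),
        avg M (fun x => |blockConv M i (blockLen m i) (f M) x| ^ p) :=
      Finset.sum_nonneg fun i _ => avg_nonneg M fun x => by positivity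
    positivity

end

end WalshKaczmarz

namespace WalshKaczmarz

/-- Strong convergence for Walsh–Kaczmarz–Fejér means in `H_p`, `0 < p < 1/2`:
there is a positive constant `c_p` with
`∑_{m=1}^n ‖σ_m^κ f‖_{H_p}^p / m^{2-2p} ≤ c_p ‖f‖_{H_p}^p`
for all `n ≥ 1` and all martingales `f ∈ H_p(G)`. -/
theorem strong_convergence_lt_half (p : ℝ) (hp0 : 0 < p) (hp : p < 1/2) :
    ∃ c : ℝ, 0 < c ∧ ∀ n : ℕ, 1 ≤ n → ∀ f : ℕ → G → ℝ, MemHp p f →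
      ∑ m ∈ Finset.Icc 1 n,
          funHpNormP p (martSigmaK f m) / (m : ℝ≥0∞) ^ (2 - 2 * p) ≤
        ENNReal.ofReal c * martHpNormP p f := by
  have hA := martConst_pos hp0 hp
  have hρ : 0 < 1 - ((2 : ℝ) ^ p) ^ 2 / 2 := sub_pos.2 (two_rpow_sq_div_two_lt_one hp)
  refine ⟨1 / (1 - ((2 : ℝ) ^ p) ^ 2 / 2) + martConst p, by positivity, fun n _ f hfp => ?_⟩
  have hf := hfp.1.isPointwiseMartingale
  obtain ⟨M, hM⟩ : ∃ M, Nat.log 2 n < M := ⟨_, Nat.lt_succ_self _⟩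
  have hE0 : 0 ≤ avg M (fun x => maxUpTo f M x ^ p) :=
    avg_nonneg M fun x => Real.rpow_nonneg (maxUpTo_nonneg f M x) p
  refine (sum_funHpNormP_le hp0 hp hf hM).trans ?_
  calc _ ≤ ENNReal.ofReal ((1 / (1 - ((2 : ℝ) ^ p) ^ 2 / 2) + martConst p) *
        avg M (fun x => maxUpTo f M x ^ p)) := by
        refine ENNReal.ofReal_le_ofReal ?_
        rw [add_mul, mul_comm (avg M _)]
        exact add_le_add (mul_le_mul_of_nonneg_right (sum_one_div_rpow_le hp n) hE0)
          (blockTotal_martingale_le hp0 hp hf hM (cyl_maxUpTo hf M)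
            fun k hk x => abs_le_maxUpTo f hk x)
    _ ≤ _ := by
        rw [ENNReal.ofReal_mul (by positivity)]
        exact mul_le_mul_right (ofReal_avg_maxUpTo_le hp0 hf M) _

end WalshKaczmarz
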